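/- Let X be a Banach space with an unconditional Schauder basis which admits a Lipschitz, C^p-smooth bump function, let M ≥ 1 be a constant for which there is a Lipschitz function μ_A : X → [0,∞), C^p-smooth on X \ {0}, homogeneous, with (1/M)‖x‖ ≤ μ_A(x) ≤ M‖x‖ for all x and ‖μ_A′(x)‖ ≤ M for all x ≠ 0, and let Z be any Banach space. Then for every η-Lipschitz map f : X → Z, every ε > 0, and every δ > 0, there exists a C^p-smooth map K : X → Z with ‖f(x) − K(x)‖ < ε for all x ∈ X and with Lipschitz constant of K at most (η + δ)(2(2 + δ)M² + 1). -/

import Mathlib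

open Function Bornology

/-- `X` has an unconditional Schauder basis: every `x` has a unique expansion
`x = ∑ⱼ xⱼ eⱼ` converging unconditionally (unconditional convergence = `HasSum`). -/
def HasUnconditionalSchauderBasis (X : Type*) [NormedAddCommGroup X] [NormedSpace ℝ X] : Prop :=
  ∃ e : ℕ → X, ∀ x : X, ∃! a : ℕ → ℝ, HasSum (fun j => a j • e j) x

/-- `X` admits a Lipschitz, `C^p`-smooth bump function. -/
def HasLipschitzSmoothBump (X : Type*) [NormedAddCommGroup X] [NormedSpace ℝ X] (p : ℕ∞) : Prop :=
  ∃ b : X → ℝ, ContDiff ℝ p b ∧ (∃ C : NNReal, LipschitzWith C b) ∧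
    IsBounded (closure (support b)) ∧ (support b).Nonempty

open Filter Topology Set

/-- The finite partial sums `F ↦ ∑ j ∈ F, aⱼ eⱼ` of unconditionally convergent series along `e`,
as bounded functions on finite sets of indices. -/
noncomputable def partialSumSpace {X : Type*} [NormedAddCommGroup X] [NormedSpace ℝ X]
    (e : ℕ → X) : Submodule ℝ (lp (fun _ : Finset ℕ => X) ⊤) where
  carrier := {g | ((∀ F : Finset ℕ, g F = ∑ j ∈ F, g {j}) ∧
    ∀ j, g {j} ∈ Submodule.span ℝ {e j}) ∧ Summable fun j => g {j}}
  add_mem' := by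
    rintro a b ⟨⟨ha, ha'⟩, ha''⟩ ⟨⟨hb, hb'⟩, hb''⟩
    refine ⟨⟨fun F => ?_, fun j => ?_⟩, ?_⟩
    · simp only [lp.coeFn_add, Pi.add_apply]
      rw [ha F, hb F, Finset.sum_add_distrib]
    · exact Submodule.add_mem _ (ha' j) (hb' j)
    · exact ha''.add hb''
  zero_mem' := by
    refine ⟨⟨fun F => ?_, fun j => ?_⟩, ?_⟩
    · simp
    · simp
    · simp
  smul_mem' := by
    rintro c a ⟨⟨ha, ha'⟩, ha''⟩
    refine ⟨⟨fun F => ?_, fun j => ?_⟩, ?_⟩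
    · simp only [lp.coeFn_smul, Pi.smul_apply]
      rw [ha F, Finset.smul_sum]
    · exact Submodule.smul_mem _ c (ha' j)
    · exact ha''.const_smul c

theorem isClosed_partialSumSpace {X : Type*} [NormedAddCommGroup X] [NormedSpace ℝ X]
    [CompleteSpace X] (e : ℕ → X) :
    IsClosed (partialSumSpace e : Set (lp (fun _ : Finset ℕ => X) ⊤)) := by
  have hev : ∀ F : Finset ℕ, Continuous fun g : lp (fun _ : Finset ℕ => X) ⊤ => g F :=
    fun F => (lp.evalCLM ℝ (fun _ : Finset ℕ => X) ⊤ F).continuous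
  have hlin : IsClosed ((⋂ F : Finset ℕ, {g : lp (fun _ : Finset ℕ => X) ⊤ |
      g F = ∑ j ∈ F, g {j}}) ∩ ⋂ j, (fun g : lp (fun _ : Finset ℕ => X) ⊤ => g {j}) ⁻¹'
        (Submodule.span ℝ {e j} : Set X)) :=
    (isClosed_iInter fun F =>
      isClosed_eq (hev F) (continuous_finsetSum _ fun j _ => hev {j})).inter
    (isClosed_iInter fun j =>
      (Submodule.closed_of_finiteDimensional (Submodule.span ℝ {e j})).preimage (hev {j}))
  refine isClosed_of_closure_subset fun g hg => ?_
  have hg1 : (∀ F : Finset ℕ, g F = ∑ j ∈ F, g {j}) ∧ ∀ j, g {j} ∈ Submodule.span ℝ {e j} :=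
    by
      have := closure_minimal (s := (partialSumSpace e : Set (lp (fun _ : Finset ℕ => X) ⊤)))
        (fun a ha => And.intro (mem_iInter.2 ha.1.1) (mem_iInter.2 ha.1.2)) hlin hg
      exact ⟨mem_iInter.1 this.1, mem_iInter.1 this.2⟩
  refine ⟨hg1, summable_iff_vanishing_norm.2 fun ε hε => ?_⟩
  obtain ⟨a, ha, hda⟩ := Metric.mem_closure_iff.1 hg (ε / 2) (half_pos hε)
  obtain ⟨s, hs⟩ := summable_iff_vanishing_norm.1 ha.2 (ε / 2) (half_pos hε)
  refine ⟨s, fun t ht => ?_⟩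
  have h1 := hs t ht
  rw [← ha.1.1 t] at h1
  rw [← hg1.1 t]
  have h2 : ‖g t - a t‖ < ε / 2 := by
    rw [dist_eq_norm] at hda
    exact (lp.norm_apply_le_norm (by simp) (g - a) t).trans_lt hda
  calc ‖g t‖ = ‖(g t - a t) + a t‖ := by rw [sub_add_cancel]
    _ ≤ ‖g t - a t‖ + ‖a t‖ := norm_add_le _ _
    _ < ε := by linarith

theorem bddAbove_norm_finset_sum_of_summable {X : Type*} [NormedAddCommGroup X]
    [CompleteSpace X] {u : ℕ → X} (hu : Summable u) :
    BddAbove (range fun F : Finset ℕ => ‖∑ j ∈ F, u j‖) := by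
  obtain ⟨s, hs⟩ := summable_iff_vanishing_norm.1 hu 1 one_pos
  refine ⟨∑ j ∈ s, ‖u j‖ + 1, ?_⟩
  rintro _ ⟨F, rfl⟩
  have h : ∑ j ∈ F, u j = ∑ j ∈ F ∩ s, u j + ∑ j ∈ F \ s, u j := by
    rw [Finset.sum_inter_add_sum_sdiff]
  simp only
  rw [h]
  refine (norm_add_le _ _).trans (add_le_add ?_ (hs _ Finset.sdiff_disjoint).le)
  exact (norm_sum_le _ _).trans (Finset.sum_le_sum_of_subset_of_nonneg
    Finset.inter_subset_right fun _ _ _ => norm_nonneg _)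

theorem HasUnconditionalSchauderBasis.nonempty_unconditionalSchauderBasis
    {X : Type*} [NormedAddCommGroup X] [NormedSpace ℝ X] [CompleteSpace X]
    (h : HasUnconditionalSchauderBasis X) : Nonempty (UnconditionalSchauderBasis ℕ ℝ X) := by
  obtain ⟨e, he⟩ := h
  have hunique : ∀ {x : X} {a b : ℕ → ℝ}, HasSum (fun j => a j • e j) x →
      HasSum (fun j => b j • e j) x → a = b := fun {x a b} ha hb => (he x).unique ha hb
  have hne : ∀ j, e j ≠ 0 := by
    intro j hj
    have h1 : HasSum (fun i => (0 : ℕ → ℝ) i • e i) 0 := by simp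
    have h2 : HasSum (fun i => (Pi.single j 1 : ℕ → ℝ) i • e i) 0 := by
      convert hasSum_zero using 2 with i
      by_cases hij : i = j
      · subst hij; simp [hj]
      · simp [hij]
    have := congrFun (hunique h1 h2) j
    simp at this
  have : IsClosed (partialSumSpace e : Set (lp (fun _ : Finset ℕ => X) ⊤)) :=
    isClosed_partialSumSpace e
  have : CompleteSpace (partialSumSpace e) := this.completeSpace_coe
  let Llin : partialSumSpace e →ₗ[ℝ] X :=
    { toFun := fun g => ∑' j, g.1 {j}
      map_add' := fun a b => a.2.2.tsum_add b.2.2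
      map_smul' := fun c a => a.2.2.tsum_const_smul c }
  have hL : ∀ g, HasSum (fun j => g.1 {j}) (Llin g) := fun g => g.2.2.hasSum
  let L : partialSumSpace e →L[ℝ] X := Llin.mkContinuous 1 fun g => by
    rw [one_mul]
    refine le_of_tendsto (hL g).norm (Eventually.of_forall fun F => ?_)
    rw [← g.2.1.1 F]
    exact lp.norm_apply_le_norm (by simp) g.1 F
  have hcoef : ∀ g : partialSumSpace e, ∃ a : ℕ → ℝ, ∀ j, g.1 {j} = a j • e j := by
    intro g
    choose a ha using fun j => Submodule.mem_span_singleton.1 (g.2.1.2 j)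
    exact ⟨a, fun j => (ha j).symm⟩
  have hinj : LinearMap.ker (L : partialSumSpace e →ₗ[ℝ] X) = ⊥ := by
    refine LinearMap.ker_eq_bot'.2 fun g hg => ?_
    obtain ⟨a, ha⟩ := hcoef g
    have h1 : HasSum (fun j => a j • e j) 0 := by
      have := hL g
      simp only [ha] at this
      rwa [show Llin g = 0 from hg] at this
    have h2 : HasSum (fun i => (0 : ℕ → ℝ) i • e i) 0 := by simp
    have h3 := hunique h1 h2
    ext F
    rw [g.2.1.1 F]
    simp [ha, h3]
  have hsurj : LinearMap.range (L : partialSumSpace e →ₗ[ℝ] X) = ⊤ := by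
    refine LinearMap.range_eq_top.2 fun x => ?_
    obtain ⟨a, ha, -⟩ := he x
    refine ⟨⟨⟨fun F => ∑ j ∈ F, a j • e j,
      memℓp_infty (bddAbove_norm_finset_sum_of_summable ha.summable)⟩,
      ⟨⟨fun F => ?_, fun j => ?_⟩, ?_⟩⟩, ?_⟩
    · simp
    · simpa using Submodule.smul_mem _ _ (Submodule.mem_span_singleton_self _)
    · simpa using ha.summable
    · change ∑' j, ∑ i ∈ {j}, a i • e i = x
      simpa using ha.tsum_eq
  let Φ := ContinuousLinearEquiv.ofBijective L hinj hsurj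
  choose f hf using fun j => SeparatingDual.exists_eq_one (R := ℝ) (hne j)
  let c : ℕ → StrongDual ℝ X := fun j =>
    (f j).comp (((lp.evalCLM ℝ (fun _ : Finset ℕ => X) ⊤ {j}).comp
      (partialSumSpace e).subtypeL).comp (Φ.symm : X →L[ℝ] partialSumSpace e))
  have hc : ∀ x, HasSum (fun j => c j x • e j) x := by
    intro x
    obtain ⟨a, ha⟩ := hcoef (Φ.symm x)
    have h1 : ∀ j, c j x = a j := by
      intro j
      change f j ((Φ.symm x).1 {j}) = a j
      rw [ha j, map_smul, hf]
      simp
    have h2 := hL (Φ.symm x)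
    rw [show Llin (Φ.symm x) = x from Φ.apply_symm_apply x] at h2
    simpa only [h1, ← ha] using h2
  refine ⟨⟨e, c, fun i j => ?_, hc⟩⟩
  have h1 : HasSum (fun i => (Pi.single j 1 : ℕ → ℝ) i • e i) (e j) := by
    convert hasSum_ite_eq j (e j) using 2 with i
    by_cases hij : i = j
    · subst hij; simp
    · simp [hij]
  convert congrFun (hunique (hc (e j)) h1) i
  rfl

section Projections

variable {X : Type*} [NormedAddCommGroup X] [NormedSpace ℝ X]

/-- The projection onto the span of the first `n` basis vectors. -/
noncomputable def headProj (b : UnconditionalSchauderBasis ℕ ℝ X) (n : ℕ) : X →L[ℝ] X :=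
  b.proj (Finset.range n)

/-- The complementary projection of `headProj`. -/
noncomputable def tailProj (b : UnconditionalSchauderBasis ℕ ℝ X) (n : ℕ) : X →L[ℝ] X :=
  ContinuousLinearMap.id ℝ X - headProj b n

variable (b : UnconditionalSchauderBasis ℕ ℝ X)

theorem headProj_apply (n : ℕ) (x : X) :
    headProj b n x = ∑ i ∈ Finset.range n, b.coord i x • b i :=
  b.proj_apply _ x

theorem tailProj_apply (n : ℕ) (x : X) : tailProj b n x = x - headProj b n x := rfl

theorem headProj_headProj (n m : ℕ) (x : X) :
    headProj b n (headProj b m x) = headProj b (min n m) x := by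
  unfold headProj
  rw [b.proj_comp]
  congr 2
  ext i
  simp

theorem headProj_headProj_of_le {n m : ℕ} (h : m ≤ n) (x : X) :
    headProj b n (headProj b m x) = headProj b m x := by
  rw [headProj_headProj, min_eq_right h]

theorem headProj_comm (n m : ℕ) (x : X) :
    headProj b n (headProj b m x) = headProj b m (headProj b n x) := by
  rw [headProj_headProj, headProj_headProj, min_comm]

theorem headProj_eq_self_of_le {n m : ℕ} (h : m ≤ n) {x : X} (hx : headProj b m x = x) :
    headProj b n x = x := by
  rw [← hx, headProj_headProj_of_le b h]

theorem tailProj_tailProj_of_le {n m : ℕ} (h : m ≤ n) (x : X) :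
    tailProj b n (tailProj b m x) = tailProj b n x := by
  simp only [tailProj_apply, map_sub, headProj_headProj_of_le b h]
  abel

theorem headProj_tailProj (n : ℕ) (x : X) : headProj b n (tailProj b n x) = 0 := by
  rw [tailProj_apply, map_sub, headProj_headProj, min_self, sub_self]

theorem tailProj_eq_self {n : ℕ} {x : X} (hx : headProj b n x = 0) : tailProj b n x = x := by
  rw [tailProj_apply, hx, sub_zero]

theorem headProj_tailProj_comm (n m : ℕ) (x : X) :
    headProj b n (tailProj b m x) = tailProj b m (headProj b n x) := by
  rw [tailProj_apply, tailProj_apply, map_sub, headProj_comm]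

theorem coord_basis (i j : ℕ) : b.coord i (b j) = if i = j then 1 else 0 := by
  rw [b.ortho]
  by_cases h : i = j
  · subst h; simp
  · simp [h]

theorem coord_headProj_of_lt {j n : ℕ} (h : j < n) (x : X) :
    b.coord j (headProj b n x) = b.coord j x := by
  rw [headProj_apply, map_sum]
  simp only [map_smul, coord_basis, smul_eq_mul, mul_ite, mul_one, mul_zero]
  simp [h]

theorem coord_headProj_of_le {j n : ℕ} (h : n ≤ j) (x : X) :
    b.coord j (headProj b n x) = 0 := by
  rw [headProj_apply, map_sum]
  simp only [map_smul, coord_basis, smul_eq_mul, mul_ite, mul_one, mul_zero]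
  simp [h]

theorem coord_tailProj {n j : ℕ} (h : n ≤ j) (x : X) :
    b.coord j (tailProj b n x) = b.coord j x := by
  rw [tailProj_apply, map_sub, coord_headProj_of_le b h, sub_zero]

theorem tendsto_headProj (x : X) : Tendsto (fun n => headProj b n x) atTop (𝓝 x) := by
  have := (b.expansion x).tendsto_sum_nat
  simpa only [headProj_apply] using this

theorem tendsto_tailProj (x : X) : Tendsto (fun n => tailProj b n x) atTop (𝓝 0) := by
  have := (tendsto_headProj b x).const_sub x
  rw [sub_self] at this
  exact this

instance finiteDimensional_range_headProj (n : ℕ) :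
    FiniteDimensional ℝ (LinearMap.range (headProj b n : X →ₗ[ℝ] X)) := by
  have h := b.range_proj_eq_span (Finset.range n)
  have h' : LinearMap.range (headProj b n : X →ₗ[ℝ] X) =
    Submodule.span ℝ (b.basis '' (Finset.range n)) := h
  rw [h']
  exact FiniteDimensional.span_of_finite ℝ ((Finset.range n).finite_toSet.image _)

/-- `B` bounds the head and tail projections as well as all diagonal operators whose entries are
bounded by one. -/
structure IsBasisBound (B : ℝ) : Prop where
  one_le : 1 ≤ B
  norm_headProj_le : ∀ n x, ‖headProj b n x‖ ≤ B * ‖x‖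
  norm_tailProj_le : ∀ n x, ‖tailProj b n x‖ ≤ B * ‖x‖
  norm_sum_le : ∀ (F : Finset ℕ) (c : ℕ → ℝ) (t : ℝ) (x : X), 0 ≤ t → (∀ j ∈ F, |c j| ≤ t) →
    ‖∑ j ∈ F, (c j * b.coord j x) • b j‖ ≤ t * (B * ‖x‖)

theorem exists_isBasisBound [CompleteSpace X] : ∃ B, IsBasisBound b B := by
  obtain ⟨C, hC⟩ := UnconditionalSchauderBasis.exists_norm_proj_le b
  have hC0 : 0 ≤ C := (norm_nonneg _).trans (hC ∅)
  have hP : ∀ (F : Finset ℕ) x, ‖b.proj F x‖ ≤ C * ‖x‖ := fun F x =>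
    (b.proj F).le_of_opNorm_le (hC F) x
  refine ⟨2 * C + 1, by linarith, fun n x => ?_, fun n x => ?_, fun F c t x ht hc => ?_⟩
  · have := hP (Finset.range n) x
    have := norm_nonneg x
    unfold headProj
    nlinarith
  · have h1 := hP (Finset.range n) x
    have h2 := norm_sub_le x (headProj b n x)
    have h3 := norm_nonneg x
    rw [tailProj_apply]
    unfold headProj at *
    nlinarith
  · obtain ⟨g, hg, hgx⟩ := exists_dual_vector'' ℝ (∑ j ∈ F, (c j * b.coord j x) • b j)
    have hgle : ∀ z : X, |g z| ≤ ‖z‖ := fun z => by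
      simpa using g.le_of_opNorm_le hg z
    set u : ℕ → ℝ := fun j => g (b.coord j x • b j) with hu
    have h1 : ‖∑ j ∈ F, (c j * b.coord j x) • b j‖ = ∑ j ∈ F, c j * u j := by
      have : g (∑ j ∈ F, (c j * b.coord j x) • b j) = ∑ j ∈ F, c j * u j := by
        simp [hu, map_sum, mul_assoc]
      rw [← this, hgx]
      rfl
    have hG : ∀ G : Finset ℕ, |∑ j ∈ G, u j| ≤ C * ‖x‖ := fun G => by
      have : ∑ j ∈ G, u j = g (b.proj G x) := by
        rw [b.proj_apply, map_sum]
      rw [this]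
      exact (hgle _).trans (hP G x)
    have h2 : ∑ j ∈ F, |u j| ≤ 2 * C * ‖x‖ := by
      rw [← Finset.sum_filter_add_sum_filter_not F (fun j => 0 ≤ u j)]
      have e1 : ∑ j ∈ F with 0 ≤ u j, |u j| = ∑ j ∈ F with 0 ≤ u j, u j :=
        Finset.sum_congr rfl fun j hj => abs_of_nonneg (Finset.mem_filter.1 hj).2
      have e2 : ∑ j ∈ F with ¬ 0 ≤ u j, |u j| = -∑ j ∈ F with ¬ 0 ≤ u j, u j := by
        rw [← Finset.sum_neg_distrib]
        exact Finset.sum_congr rfl fun j hj =>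
          abs_of_neg (not_le.1 (Finset.mem_filter.1 hj).2)
      rw [e1, e2]
      have a1 := abs_le.1 (hG (F.filter fun j => 0 ≤ u j))
      have a2 := abs_le.1 (hG (F.filter fun j => ¬ 0 ≤ u j))
      linarith [a1.2, a2.1]
    rw [h1]
    calc ∑ j ∈ F, c j * u j ≤ ∑ j ∈ F, t * |u j| := by
          refine Finset.sum_le_sum fun j hj => (le_abs_self _).trans ?_
          rw [abs_mul]
          exact mul_le_mul_of_nonneg_right (hc j hj) (abs_nonneg _)
      _ = t * ∑ j ∈ F, |u j| := by rw [Finset.mul_sum]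
      _ ≤ t * ((2 * C + 1) * ‖x‖) := by
          refine mul_le_mul_of_nonneg_left (h2.trans ?_) ht
          nlinarith [norm_nonneg x]

variable {b}

theorem IsBasisBound.norm_sum_le_tail {B : ℝ} (hB : IsBasisBound b B) (F : Finset ℕ)
    (c : ℕ → ℝ) (t : ℝ) (x : X) (n : ℕ) (ht : 0 ≤ t) (hc : ∀ j ∈ F, |c j| ≤ t)
    (hn : ∀ j ∈ F, c j ≠ 0 → n ≤ j) :
    ‖∑ j ∈ F, (c j * b.coord j x) • b j‖ ≤ t * (B * ‖tailProj b n x‖) := by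
  have : ∑ j ∈ F, (c j * b.coord j x) • b j =
      ∑ j ∈ F, (c j * b.coord j (tailProj b n x)) • b j := by
    refine Finset.sum_congr rfl fun j hj => ?_
    by_cases h0 : c j = 0
    · simp [h0]
    · rw [coord_tailProj b (hn j hj h0)]
  rw [this]
  exact hB.norm_sum_le F c t _ ht hc

end Projections

section Cutoff

variable {X : Type*} [NormedAddCommGroup X] [NormedSpace ℝ X]

/-- `H` is a Lipschitz, `C^p`-smooth function vanishing on the unit ball and equal to one outside
the ball of radius `R`. -/
structure IsSmoothCutoff (p : ℕ∞) (H : X → ℝ) (R Λ : ℝ) : Prop where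
  contDiff : ContDiff ℝ p H
  nonneg : ∀ x, 0 ≤ H x
  le_one : ∀ x, H x ≤ 1
  eq_zero : ∀ x, ‖x‖ ≤ 1 → H x = 0
  eq_one : ∀ x, R ≤ ‖x‖ → H x = 1
  abs_sub_le : ∀ x y, |H x - H y| ≤ Λ * ‖x - y‖
  one_le_radius : 1 ≤ R
  nonneg_const : 0 ≤ Λ

theorem exists_isSmoothCutoff {p : ℕ∞} {M : ℝ} (hM : 1 ≤ M) {g : X → ℝ}
    (hlip : ∃ C : NNReal, LipschitzWith C g) (hsmooth : ContDiffOn ℝ p g {(0 : X)}ᶜ)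
    (hnonneg : ∀ x, 0 ≤ g x)
    (hlower : ∀ x, (1 / M) * ‖x‖ ≤ g x) (hupper : ∀ x, g x ≤ M * ‖x‖) :
    ∃ (H : X → ℝ) (R Λ : ℝ), IsSmoothCutoff p H R Λ := by
  obtain ⟨C, hC⟩ := hlip
  have hM0 : 0 < M := by linarith
  let β : ContDiffBump (0 : ℝ) := ⟨M, 2 * M, hM0, by linarith⟩
  have hβ : ContDiff ℝ p (β : ℝ → ℝ) := β.contDiff
  obtain ⟨D, hD⟩ := ContDiff.lipschitzWith_of_hasCompactSupport β.hasCompactSupport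
    (β.contDiff (n := 1)) one_ne_zero
  have hz : ∀ x : X, ‖x‖ ≤ 1 → 1 - β (g x) = 0 := by
    intro x hx
    rw [β.one_of_mem_closedBall, sub_self]
    rw [mem_closedBall_zero_iff, Real.norm_of_nonneg (hnonneg x)]
    exact (hupper x).trans (mul_le_of_le_one_right hM0.le hx)
  refine ⟨fun x => 1 - β (g x), 2 * M ^ 2, D * C, ?_, fun x => ?_, fun x => ?_, hz,
    fun x hx => ?_, fun x y => ?_, by nlinarith, by positivity⟩
  · rw [contDiff_iff_contDiffAt]
    intro x
    by_cases hx : x = 0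
    · refine (contDiffAt_const (c := (0 : ℝ))).congr_of_eventuallyEq ?_
      filter_upwards [Metric.closedBall_mem_nhds x one_pos] with y hy
      subst hx
      exact hz y (mem_closedBall_zero_iff.1 hy)
    · exact contDiffAt_const.sub (hβ.contDiffAt.comp x
        (hsmooth.contDiffAt (isOpen_compl_singleton.mem_nhds hx)))
  · linarith [β.le_one (x := g x)]
  · linarith [β.nonneg (x := g x)]
  · rw [β.zero_of_le_dist, sub_zero]
    rw [dist_zero_right, Real.norm_of_nonneg (hnonneg x)]
    refine le_trans ?_ (hlower x)
    change 2 * M ≤ _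
    rw [one_div, inv_mul_eq_div, le_div_iff₀ hM0]
    nlinarith
  · have h := (hD.comp hC).dist_le_mul x y
    rw [dist_eq_norm, dist_eq_norm, Real.norm_eq_abs] at h
    rw [show 1 - β (g x) - (1 - β (g y)) = -(β (g x) - β (g y)) by ring, abs_neg]
    exact_mod_cast h

end Cutoff

theorem exists_smooth_locally_head_approx {X : Type*} [NormedAddCommGroup X] [NormedSpace ℝ X]
    {b : UnconditionalSchauderBasis ℕ ℝ X} {B : ℝ} (hB : IsBasisBound b B)
    {p : ℕ∞} {H : X → ℝ} {R Λ : ℝ} (hH : IsSmoothCutoff p H R Λ) :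
    ∃ (Ψ : X → X) (D C κ : ℝ), 0 < κ ∧ 0 ≤ D ∧ 0 ≤ C ∧ ContDiff ℝ p Ψ ∧
      (∀ x, ‖Ψ x - x‖ ≤ D) ∧ (∀ x y, ‖Ψ x - Ψ y‖ ≤ C * ‖x - y‖) ∧
      ∀ n x, ‖tailProj b n x‖ < κ → headProj b n (Ψ x) = Ψ x := by
  have hB1 := hB.one_le
  have hB0 : 0 < B := by linarith
  have hR1 := hH.one_le_radius
  have hΛ := hH.nonneg_const
  set Ψ : X → X := fun x => ∑' n, (H (tailProj b n x) * b.coord n x) • b n with hΨ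
  have hsum : ∀ n x, ‖tailProj b n x‖ < B⁻¹ →
      Ψ x = ∑ j ∈ Finset.range n, (H (tailProj b j x) * b.coord j x) • b j := by
    intro n x hx
    refine tsum_eq_sum fun j hj => ?_
    have hj' : n ≤ j := by simpa using hj
    rw [hH.eq_zero, zero_mul, zero_smul]
    rw [← tailProj_tailProj_of_le b hj']
    refine (hB.norm_tailProj_le _ _).trans ?_
    calc B * ‖tailProj b n x‖ ≤ B * B⁻¹ := by gcongr
      _ = 1 := mul_inv_cancel₀ hB0.ne'
  have hsmall : ∀ x, ∀ r > 0, ∀ᶠ n in atTop, ‖tailProj b n x‖ < r := by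
    intro x r hr
    have := (tendsto_tailProj b x).norm
    rw [norm_zero] at this
    exact this.eventually (gt_mem_nhds hr)
  have hκ : 0 < B⁻¹ := inv_pos.2 hB0
  have hκ1 : B⁻¹ ≤ 1 := inv_le_one_of_one_le₀ hB1
  have hD : ∀ x, ‖Ψ x - x‖ ≤ B * R + 1 := by
    intro x
    obtain ⟨N, hN⟩ := (hsmall x _ hκ).exists
    have hex : ∃ n, ‖tailProj b n x‖ ≤ R :=
      (hsmall x R (by linarith)).exists.imp fun n h => h.le
    classical
    have key := hB.norm_sum_le_tail (Finset.range N) (fun j => 1 - H (tailProj b j x)) 1 x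
      (Nat.find hex) zero_le_one
      (fun j _ => by
        rw [abs_le]
        constructor <;> linarith [hH.nonneg (tailProj b j x), hH.le_one (tailProj b j x)])
      (fun j _ hj => by
        refine Nat.find_min' hex (le_of_not_ge fun h => hj ?_)
        rw [hH.eq_one _ h, sub_self])
    have e : Ψ x - x = -(∑ j ∈ Finset.range N,
        ((1 - H (tailProj b j x)) * b.coord j x) • b j) - tailProj b N x := by
      rw [hsum N x hN, tailProj_apply, headProj_apply]
      simp only [sub_mul, one_mul, sub_smul, Finset.sum_sub_distrib]
      abel
    rw [e]
    refine (norm_sub_le _ _).trans ?_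
    rw [norm_neg]
    have := Nat.find_spec hex
    nlinarith
  refine ⟨Ψ, B * R + 1, max (B + Λ * B * (B * (R + B))) (2 * (B * R + 1) + 1), B⁻¹, hκ,
    by positivity, by positivity, ?_, hD, fun x y => ?_, fun n x hx => ?_⟩
  · rw [contDiff_iff_contDiffAt]
    intro x
    obtain ⟨N, hN⟩ := (hsmall x _ hκ).exists
    have hopen : ∀ᶠ y in 𝓝 x, ‖tailProj b N y‖ < B⁻¹ :=
      (tailProj b N).continuous.norm.continuousAt.eventually (gt_mem_nhds hN)
    refine ContDiffAt.congr_of_eventuallyEq ?_ (hopen.mono fun y hy => hsum N y hy)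
    refine ContDiff.contDiffAt ?_
    refine ContDiff.sum fun j _ => ?_
    exact ((hH.contDiff.comp (tailProj b j).contDiff).mul (b.coord j).contDiff).smul contDiff_const
  · rcases le_or_gt ‖x - y‖ 1 with h1 | h1
    · refine le_trans ?_ (mul_le_mul_of_nonneg_right (le_max_left _ _) (norm_nonneg _))
      obtain ⟨N, hNx, hNy⟩ := ((hsmall x _ hκ).and (hsmall y _ hκ)).exists
      have hex : ∃ n, ‖tailProj b n y‖ ≤ R + B :=
        (hsmall y (R + B) (by linarith)).exists.imp fun n h => h.le
      classical
      have k1 := hB.norm_sum_le (Finset.range N) (fun j => H (tailProj b j x)) 1 (x - y)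
        zero_le_one (fun j _ => by
          rw [abs_of_nonneg (hH.nonneg _)]
          exact hH.le_one _)
      have hdiff : ∀ j, ‖tailProj b j x - tailProj b j y‖ ≤ B * ‖x - y‖ := fun j => by
        rw [← map_sub]
        exact hB.norm_tailProj_le _ _
      have k2 := hB.norm_sum_le_tail (Finset.range N)
        (fun j => H (tailProj b j x) - H (tailProj b j y)) (Λ * (B * ‖x - y‖)) y
        (Nat.find hex) (by positivity)
        (fun j _ => (hH.abs_sub_le _ _).trans (mul_le_mul_of_nonneg_left (hdiff j) hΛ))
        (fun j _ hj => by
          refine Nat.find_min' hex (le_of_not_ge fun h => hj ?_)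
          have h2 : ‖tailProj b j y‖ ≤ ‖tailProj b j x‖ + B * ‖x - y‖ := by
            have := norm_sub_norm_le (tailProj b j y) (tailProj b j x)
            rw [norm_sub_rev] at this
            linarith [hdiff j]
          rw [hH.eq_one _ (by nlinarith), hH.eq_one _ (by linarith), sub_self])
      have hf := Nat.find_spec hex
      have e : Ψ x - Ψ y = ∑ j ∈ Finset.range N, (H (tailProj b j x) * b.coord j (x - y)) • b j +
          ∑ j ∈ Finset.range N,
            ((H (tailProj b j x) - H (tailProj b j y)) * b.coord j y) • b j := by
        rw [hsum N x hNx, hsum N y hNy, ← Finset.sum_sub_distrib, ← Finset.sum_add_distrib]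
        refine Finset.sum_congr rfl fun j _ => ?_
        rw [← sub_smul, ← add_smul, map_sub]
        congr 1
        ring
      rw [e]
      refine (norm_add_le _ _).trans ((add_le_add k1 k2).trans ?_)
      have h3 : Λ * (B * ‖x - y‖) * (B * ‖tailProj b (Nat.find hex) y‖) ≤
          Λ * (B * ‖x - y‖) * (B * (R + B)) := by gcongr
      calc _ ≤ 1 * (B * ‖x - y‖) + Λ * (B * ‖x - y‖) * (B * (R + B)) := by linarith
        _ = _ := by ring
    · refine le_trans ?_ (mul_le_mul_of_nonneg_right (le_max_right _ _) (norm_nonneg _))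
      have e : Ψ x - Ψ y = (Ψ x - x) - (Ψ y - y) + (x - y) := by abel
      rw [e]
      have := (norm_add_le ((Ψ x - x) - (Ψ y - y)) (x - y)).trans
        (add_le_add_left (norm_sub_le _ _) _)
      have hpos : 0 ≤ B * R := by positivity
      nlinarith [hD x, hD y]
  · rw [hsum n x hx, map_sum]
    refine Finset.sum_congr rfl fun j hj => ?_
    have hj' : j < n := Finset.mem_range.1 hj
    rw [map_smul, headProj, b.proj_apply_basis_mem, if_pos hj]

/-- If the sets attached to the members of a family `Q` can be moved by uniformly positive steps as
long as they stay in a compact set, then greedy steps would contradict compactness; hence `Q` is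
empty. -/
theorem not_of_uniform_steps {X : Type*} [NormedAddCommGroup X] [CompleteSpace X]
    (Q : Set X → ℝ → Prop) {c : ℝ} (hc : 0 ≤ c)
    (hQ : ∀ Y s, Q Y s → IsCompact Y ∧ 0 < s)
    (hstep : ∀ C : Set X, IsCompact C → ∃ w₀ > 0, ∀ Y s, Q Y s → Y ⊆ C →
      ∀ w, 0 < w → w ≤ w₀ → w ≤ s →
        ∃ Y', Q Y' (s - w) ∧ ∀ y' ∈ Y', ∃ y ∈ Y, ‖y' - y‖ ≤ c * w) (Y : Set X) (s : ℝ) :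
    ¬ Q Y s := by
  intro hYs
  let St := {q : Set X × ℝ // Q q.1 q.2}
  have hnext : ∀ q : St, ∃ (q' : St) (w : ℝ), 0 < w ∧ q'.1.2 = q.1.2 - w ∧
      (∀ y' ∈ q'.1.1, ∃ y ∈ q.1.1, ‖y' - y‖ ≤ c * w) ∧
      ∀ (Y' : Set X) (w' : ℝ), 0 < w' → Q Y' (q.1.2 - w') →
        (∀ y' ∈ Y', ∃ y ∈ q.1.1, ‖y' - y‖ ≤ c * w') → w' ≤ 2 * w := by
    rintro ⟨⟨Y, s⟩, hq⟩
    set S : Set ℝ := {w | 0 < w ∧ ∃ Y', Q Y' (s - w) ∧ ∀ y' ∈ Y', ∃ y ∈ Y, ‖y' - y‖ ≤ c * w}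
      with hS
    have hbdd : BddAbove S := ⟨s, fun w ⟨_, Y', hY', _⟩ => by linarith [(hQ _ _ hY').2]⟩
    have hne : S.Nonempty := by
      obtain ⟨w₀, hw₀, h⟩ := hstep Y (hQ _ _ hq).1
      have hs := (hQ _ _ hq).2
      exact ⟨min w₀ s, lt_min hw₀ hs,
        h Y s hq subset_rfl _ (lt_min hw₀ hs) (min_le_left _ _) (min_le_right _ _)⟩
    have hpos : 0 < sSup S := by
      obtain ⟨w, hw⟩ := hne
      exact hw.1.trans_le (le_csSup hbdd hw)
    obtain ⟨w, ⟨hw, Y', hY', hnear⟩, hlt⟩ := exists_lt_of_lt_csSup hne (half_lt_self hpos)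
    refine ⟨⟨⟨Y', s - w⟩, hY'⟩, w, hw, rfl, hnear, fun Y'' w' hw' hQ' hn => ?_⟩
    have := le_csSup hbdd (show w' ∈ S from ⟨hw', Y'', hQ', hn⟩)
    linarith
  choose next wt hwt hs hnear hmax using hnext
  let q : ℕ → St := fun k => next^[k] ⟨⟨Y, s⟩, hYs⟩
  have hq : ∀ k, q (k + 1) = next (q k) := fun k => Function.iterate_succ_apply' _ _ _
  let σ : ℕ → ℝ := fun k => (q k).1.2
  have hσ : ∀ k, σ (k + 1) = σ k - wt (q k) := fun k => by
    simp only [σ, hq, hs]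
  have hσpos : ∀ k, 0 < σ k := fun k => (hQ _ _ (q k).2).2
  have hanti : Antitone σ := antitone_nat_of_succ_le fun k => by
    rw [hσ]
    linarith [hwt (q k)]
  have hfar : ∀ N j, ∀ y ∈ (q (N + j)).1.1, ∃ z ∈ (q N).1.1, ‖y - z‖ ≤ c * (σ N - σ (N + j)) := by
    intro N j
    induction j with
    | zero => exact fun y hy => ⟨y, hy, by simp⟩
    | succ j ih =>
      intro y hy
      rw [← add_assoc, hq] at hy
      obtain ⟨y', hy', h1⟩ := hnear _ y hy
      obtain ⟨z, hz, h2⟩ := ih y' hy'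
      refine ⟨z, hz, (norm_sub_le_norm_sub_add_norm_sub y y' z).trans ?_⟩
      rw [← add_assoc, hσ]
      linarith
  have htb : TotallyBounded (⋃ k, (q k).1.1) := by
    rw [Metric.totallyBounded_iff]
    intro r hr
    obtain ⟨l, hl⟩ : ∃ l, Tendsto σ atTop (𝓝 l) :=
      ⟨_, tendsto_atTop_ciInf hanti ⟨0, by rintro _ ⟨k, rfl⟩; exact (hσpos k).le⟩⟩
    have hlim : Tendsto (fun N => c * (σ N - l)) atTop (𝓝 0) := by
      simpa using (hl.sub_const l).const_mul c
    obtain ⟨N, hN⟩ := (hlim.eventually (gt_mem_nhds (half_pos hr))).exists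
    have hcomp : IsCompact (⋃ k ∈ Finset.range (N + 1), (q k).1.1) :=
      (Finset.range (N + 1)).isCompact_biUnion fun k _ => (hQ _ _ (q k).2).1
    obtain ⟨t, ht, hcov⟩ := Metric.totallyBounded_iff.1 hcomp.totallyBounded (r / 2) (half_pos hr)
    refine ⟨t, ht, fun y hy => ?_⟩
    obtain ⟨k, hk⟩ := mem_iUnion.1 hy
    obtain ⟨z, hz, hyz⟩ : ∃ z ∈ ⋃ k ∈ Finset.range (N + 1), (q k).1.1, dist y z < r / 2 := by
      rcases le_total k N with h | h
      · refine ⟨y, mem_iUnion₂.2 ⟨k, Finset.mem_range.2 (by omega), hk⟩, ?_⟩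
        rw [dist_self]
        exact half_pos hr
      · obtain ⟨j, rfl⟩ := Nat.exists_eq_add_of_le h
        obtain ⟨z, hz, h1⟩ := hfar N j y hk
        refine ⟨z, mem_iUnion₂.2 ⟨N, Finset.mem_range.2 (by omega), hz⟩, ?_⟩
        rw [dist_eq_norm]
        have := hanti.le_of_tendsto hl (N + j)
        refine (h1.trans (mul_le_mul_of_nonneg_left ?_ hc)).trans_lt hN
        linarith
    obtain ⟨a, ha, hza⟩ := mem_iUnion₂.1 (hcov hz)
    refine mem_iUnion₂.2 ⟨a, ha, ?_⟩
    rw [Metric.mem_ball] at hza ⊢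
    linarith [dist_triangle y z a]
  have hC : IsCompact (closure (⋃ k, (q k).1.1)) :=
    htb.closure.isCompact_of_isClosed isClosed_closure
  obtain ⟨w₀, hw₀, hw⟩ := hstep _ hC
  have hsub : ∀ k, (q k).1.1 ⊆ closure (⋃ k, (q k).1.1) := fun k =>
    (subset_iUnion (fun k => (q k).1.1) k).trans subset_closure
  have hstepk : ∀ k, w₀ ≤ 2 * wt (q k) := by
    intro k
    have hlt : w₀ < σ k := by
      by_contra! hle
      obtain ⟨Y', hY', -⟩ := hw _ _ (q k).2 (hsub k) (σ k) (hσpos k) hle le_rfl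
      have := (hQ _ _ hY').2
      simp [σ] at this
    obtain ⟨Y', hY', hn⟩ := hw _ _ (q k).2 (hsub k) w₀ hw₀ le_rfl hlt.le
    exact hmax _ _ _ hw₀ hY' hn
  have hdecr : ∀ k : ℕ, σ k ≤ σ 0 - k * (w₀ / 2) := by
    intro k
    induction k with
    | zero => simp
    | succ k ih =>
      rw [hσ]
      push_cast
      linarith [hstepk k]
  obtain ⟨k, hk⟩ := exists_nat_gt (σ 0 / (w₀ / 2))
  rw [div_lt_iff₀ (half_pos hw₀)] at hk
  linarith [hdecr k, hσpos k]

section Shrinking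

variable {X : Type*} [NormedAddCommGroup X] [NormedSpace ℝ X]

theorem exists_uniform_first_order_bound {φ : X → ℝ} (hφ : ContDiff ℝ 1 φ) {C : Set X}
    (hC : IsCompact C) {a e : ℝ} (ha : 0 ≤ a) (he : 0 < e) :
    ∃ w₀ > 0, ∀ y ∈ C, ∀ w, 0 ≤ w → w ≤ w₀ → ∀ r : X, ‖r‖ ≤ a →
      φ (y + w • r) ≤ φ y + w * fderiv ℝ φ y r + w * e := by
  have hcont : Continuous (fderiv ℝ φ) := hφ.continuous_fderiv one_ne_zero
  have hdiff : Differentiable ℝ φ := hφ.differentiable one_ne_zero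
  have ha1 : 0 < a + 1 := by linarith
  have hunif := hC.uniformContinuousAt_of_continuousAt (fderiv ℝ φ)
    (fun y _ => hcont.continuousAt) (Metric.dist_mem_uniformity (div_pos he ha1))
  obtain ⟨d, hd, hd'⟩ := Metric.mem_uniformity_dist.1 hunif
  refine ⟨d / (a + 1) / 2, by positivity, fun y hy w hw hww r hr => ?_⟩
  obtain ⟨z, hz, hmv⟩ := domain_mvt (f := φ) (s := univ) (x := y) (y := y + w • r)
    (f' := fderiv ℝ φ) (fun x _ => (hdiff x).hasFDerivAt.hasFDerivWithinAt) convex_univ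
    (mem_univ _) (mem_univ _)
  have hwr : ‖w • r‖ < d := by
    rw [norm_smul, Real.norm_of_nonneg hw]
    calc w * ‖r‖ ≤ d / (a + 1) / 2 * (a + 1) := by gcongr; linarith
      _ = d / 2 := by field_simp
      _ < d := half_lt_self hd
  have hyz : dist y z < d := by
    have := norm_sub_le_of_mem_segment hz
    rw [add_sub_cancel_left] at this
    rw [dist_comm, dist_eq_norm]
    exact this.trans_lt hwr
  have h1 : dist (fderiv ℝ φ y) (fderiv ℝ φ z) < e / (a + 1) := hd' hyz hy
  rw [add_sub_cancel_left, map_smul, smul_eq_mul] at hmv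
  have h2 : fderiv ℝ φ z r ≤ fderiv ℝ φ y r + e := by
    have h3 := (fderiv ℝ φ z - fderiv ℝ φ y).le_opNorm r
    rw [← dist_eq_norm, dist_comm] at h3
    have h4 : dist (fderiv ℝ φ y) (fderiv ℝ φ z) * ‖r‖ ≤ e / (a + 1) * (a + 1) := by
      gcongr
      linarith
    rw [div_mul_cancel₀ _ ha1.ne'] at h4
    have h5 := (le_abs_self _).trans (h3.trans h4)
    simp only [sub_apply] at h5
    linarith
  nlinarith

variable {b : UnconditionalSchauderBasis ℕ ℝ X}

theorem coord_eq_zero_of_headProj_eq_zero {n j : ℕ} (hj : j < n) {x : X}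
    (hx : headProj b n x = 0) : b.coord j x = 0 := by
  rw [← coord_headProj_of_lt b hj, hx, map_zero]

theorem coord_eq_zero_of_headProj_eq_self {n j : ℕ} (hj : n ≤ j) {x : X}
    (hx : headProj b n x = x) : b.coord j x = 0 := by
  rw [← hx, coord_headProj_of_le b hj]

theorem headProj_eq_zero_of_le {n m : ℕ} (h : m ≤ n) {x : X} (hx : headProj b n x = 0) :
    headProj b m x = 0 := by
  have := headProj_headProj b m n x
  rw [hx, map_zero, min_eq_left h] at this
  exact this.symm

/-- A basis of a space with a smooth cutoff function is shrinking. -/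
theorem exists_abs_le_of_headProj_eq_zero [CompleteSpace X] {B : ℝ} (hB : IsBasisBound b B)
    {p : ℕ∞} (hp : 1 ≤ p) {H : X → ℝ} {R Λ : ℝ} (hH : IsSmoothCutoff p H R Λ) (g : X →L[ℝ] ℝ)
    {c : ℝ} (hc : 0 < c) :
    ∃ N, ∀ n, N ≤ n → ∀ r, headProj b n r = 0 → |g r| ≤ c * ‖r‖ := by
  by_contra! hcon
  have hblock : ∀ N, ∃ r n, ‖r‖ ≤ 1 ∧ headProj b N r = 0 ∧ headProj b n r = r ∧ c ≤ g r := by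
    intro N
    obtain ⟨n, hn, r, hr, hgr⟩ := hcon N
    have hev : ∀ᶠ k in atTop, c * ‖headProj b k r‖ < |g (headProj b k r)| := by
      have ht := tendsto_headProj b r
      exact (ht.norm.const_mul c).eventually_lt ((g.continuous.tendsto r).comp ht).abs hgr
    obtain ⟨k, hk⟩ := hev.exists
    set r' := headProj b k r with hr'
    have hpos : 0 < ‖r'‖ := by
      rw [norm_pos_iff]
      intro h0
      simp [h0] at hk
    have h0 : headProj b N r' = 0 := by
      rw [hr', headProj_comm, headProj_eq_zero_of_le hn hr, map_zero]
    have h1 : headProj b k r' = r' := headProj_headProj_of_le b le_rfl r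
    obtain ⟨θ, hθ, hθg⟩ : ∃ θ : ℝ, |θ| = 1 ∧ |g r'| = θ * g r' := by
      rcases le_total 0 (g r') with h | h
      · exact ⟨1, by simp, by rw [abs_of_nonneg h, one_mul]⟩
      · exact ⟨-1, by simp, by rw [abs_of_nonpos h, neg_one_mul]⟩
    refine ⟨(‖r'‖⁻¹ * θ) • r', k, ?_, ?_, ?_, ?_⟩
    · rw [norm_smul, norm_mul, norm_inv, norm_norm, Real.norm_eq_abs θ, hθ, mul_one,
        inv_mul_cancel₀ hpos.ne']
    · rw [map_smul, h0, smul_zero]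
    · rw [map_smul, h1]
    · rw [map_smul, smul_eq_mul, mul_assoc, ← hθg, inv_mul_eq_div, le_div_iff₀ hpos]
      exact hk.le
  have hB0 : 0 < B := by linarith [hB.one_le]
  have hR1 := hH.one_le_radius
  set l : ℝ := R * (B * (‖g‖ + 1)) / c with hl
  have hl0 : 0 < l := by positivity
  set φ : X → ℝ := fun x => H (l • x) with hφ
  have hφ1 : ContDiff ℝ 1 φ :=
    (hH.contDiff.of_le (by exact_mod_cast hp)).comp (contDiff_const_smul l)
  let P : X → ℝ → Prop := fun y s => 0 ≤ s ∧ φ y ≤ (1 - s) / 2 ∧ ∃ n, headProj b n y = y ∧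
    ∃ σ : ℕ → ℝ, (∀ j, |σ j| ≤ 1) ∧
      (1 - s) * c ≤ g (∑ j ∈ Finset.range n, (σ j * b.coord j y) • b j)
  have hPpos : ∀ y s, P y s → 0 < s := by
    rintro y s ⟨hs, hy, n, hn, σ, hσ, hle⟩
    rcases hs.eq_or_lt with rfl | h
    swap
    · exact h
    exfalso
    have h1 := hB.norm_sum_le (Finset.range n) σ 1 y zero_le_one fun j _ => hσ j
    have h2 := (le_abs_self _).trans
      (g.le_opNorm (∑ j ∈ Finset.range n, (σ j * b.coord j y) • b j))
    have h3 : c ≤ ‖y‖ * (B * (‖g‖ + 1)) := by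
      have h4 : ‖g‖ * ‖∑ j ∈ Finset.range n, (σ j * b.coord j y) • b j‖ ≤ ‖g‖ * (1 * (B * ‖y‖)) :=
        mul_le_mul_of_nonneg_left h1 (norm_nonneg _)
      have h5 : 0 ≤ B * ‖y‖ := by positivity
      linarith
    have h6 : φ y = 1 := by
      refine hH.eq_one _ ?_
      rw [norm_smul, Real.norm_of_nonneg hl0.le, hl, div_mul_eq_mul_div, le_div_iff₀ hc]
      nlinarith
    rw [h6] at hy
    norm_num at hy
  refine not_of_uniform_steps (fun Y s => ∃ y, Y = {y} ∧ P y s) zero_le_one ?_ ?_ {0} 1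
    ⟨0, rfl, zero_le_one, ?_, 0, by simp, 0, by simp, by simp⟩
  · rintro _ s ⟨y, rfl, hy⟩
    exact ⟨isCompact_singleton, hPpos y s hy⟩
  · intro C hC
    obtain ⟨w₀, hw₀, hw⟩ := exists_uniform_first_order_bound hφ1 hC zero_le_one one_half_pos
    refine ⟨w₀, hw₀, ?_⟩
    rintro _ s ⟨y, rfl, hs, hy, n, hn, σ, hσ, hle⟩ hsub w hw0 hww hws
    obtain ⟨r, k, hr1, hr0, hrk, hgr⟩ := hblock n
    obtain ⟨θ, hθ, hθ'⟩ : ∃ θ : ℝ, |θ| = 1 ∧ fderiv ℝ φ y (θ • r) ≤ 0 := by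
      rcases le_total 0 (fderiv ℝ φ y r) with h | h
      · exact ⟨-1, by simp, by simpa using h⟩
      · exact ⟨1, by simp, by simpa using h⟩
    have hθ2 : θ * θ = 1 := by rw [← abs_mul_abs_self, hθ, one_mul]
    have hnorm : ‖θ • r‖ ≤ 1 := by rwa [norm_smul, Real.norm_eq_abs, hθ, one_mul]
    refine ⟨{y + w • θ • r}, ⟨y + w • θ • r, rfl, by linarith, ?_, max n k, ?_,
      fun j => if j < n then σ j else θ, fun j => ?_, ?_⟩, ?_⟩
    · have := hw y (hsub rfl) w hw0.le hww (θ • r) hnorm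
      nlinarith
    · rw [map_add, map_smul, map_smul, headProj_eq_self_of_le b (le_max_left _ _) hn,
        headProj_eq_self_of_le b (le_max_right _ _) hrk]
    · change |if j < n then σ j else θ| ≤ 1
      split_ifs
      exacts [hσ j, hθ.le]
    · have e : ∑ j ∈ Finset.range (max n k),
          ((if j < n then σ j else θ) * b.coord j (y + w • θ • r)) • b j =
          ∑ j ∈ Finset.range n, (σ j * b.coord j y) • b j + w • r := by
        have e1 : w • r = ∑ j ∈ Finset.range (max n k), (w * b.coord j r) • b j := by
          conv_lhs => rw [← headProj_eq_self_of_le b (le_max_right n k) hrk, headProj_apply]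
          rw [Finset.smul_sum]
          simp only [smul_smul]
        have e2 : ∑ j ∈ Finset.range n, (σ j * b.coord j y) • b j =
            ∑ j ∈ Finset.range (max n k), (σ j * b.coord j y) • b j := by
          refine Finset.sum_subset (Finset.range_mono (le_max_left _ _)) fun j _ hj => ?_
          rw [coord_eq_zero_of_headProj_eq_self (not_lt.1 fun h => hj (Finset.mem_range.2 h)) hn]
          simp
        rw [e1, e2, ← Finset.sum_add_distrib]
        refine Finset.sum_congr rfl fun j _ => ?_
        rw [← add_smul, map_add, map_smul, map_smul]
        congr 1
        split_ifs with h
        · rw [coord_eq_zero_of_headProj_eq_zero h hr0]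
          simp
        · rw [coord_eq_zero_of_headProj_eq_self (not_lt.1 h) hn]
          simp only [smul_eq_mul, mul_zero, zero_add]
          linear_combination (w * b.coord j r) * hθ2
      rw [e, map_add, map_smul, smul_eq_mul]
      nlinarith
    · rintro _ rfl
      refine ⟨y, rfl, ?_⟩
      rw [add_sub_cancel_left, norm_smul, Real.norm_of_nonneg hw0.le, one_mul]
      exact mul_le_of_le_one_right hw0.le hnorm
  · simp only [hφ, smul_zero]
    rw [hH.eq_zero 0 (by simp)]
    norm_num

/-- Vectors with large support barely increase the potential `φ`, uniformly on compact sets. -/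
theorem exists_uniform_tail_bound [CompleteSpace X] {B : ℝ} (hB : IsBasisBound b B)
    {p : ℕ∞} (hp : 1 ≤ p) {H : X → ℝ} {R Λ : ℝ} (hH : IsSmoothCutoff p H R Λ) {φ : X → ℝ}
    (hφ : ContDiff ℝ 1 φ) {C : Set X} (hC : IsCompact C) {a e : ℝ} (ha : 0 ≤ a) (he : 0 < e) :
    ∃ w₀ > 0, ∃ m, ∀ y ∈ C, ∀ w, 0 ≤ w → w ≤ w₀ → ∀ r : X, headProj b m r = 0 → ‖r‖ ≤ a →
      φ (y + w • r) ≤ φ y + w * e := by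
  obtain ⟨w₀, hw₀, hw⟩ := exists_uniform_first_order_bound hφ hC ha (half_pos he)
  have ha1 : 0 < a + 1 := by linarith
  have hd : 0 < e / 4 / (a + 1) := by positivity
  have hcomp : IsCompact (fderiv ℝ φ '' C) := hC.image (hφ.continuous_fderiv one_ne_zero)
  obtain ⟨t, ht, hcov⟩ := Metric.totallyBounded_iff.1 hcomp.totallyBounded _ hd
  choose N hN using fun g : X →L[ℝ] ℝ => exists_abs_le_of_headProj_eq_zero hB hp hH g hd
  obtain ⟨m, hm⟩ := (ht.image N).bddAbove
  refine ⟨w₀, hw₀, m, fun y hy w hw0 hww r hr0 hr => (hw y hy w hw0 hww r hr).trans ?_⟩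
  obtain ⟨g, hg, hyg⟩ := mem_iUnion₂.1 (hcov (mem_image_of_mem _ hy))
  rw [Metric.mem_ball, dist_eq_norm] at hyg
  have h1 := (le_abs_self _).trans (hN g m (hm (mem_image_of_mem _ hg)) r hr0)
  have h2 := (le_abs_self _).trans ((fderiv ℝ φ y - g).le_of_opNorm_le hyg.le r)
  rw [sub_apply] at h2
  have h3 : e / 4 / (a + 1) * ‖r‖ ≤ e / 4 / (a + 1) * (a + 1) := by
    gcongr
    linarith
  rw [div_mul_cancel₀ _ ha1.ne'] at h3
  have h4 : fderiv ℝ φ y r ≤ e / 2 := by linarith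
  nlinarith

end Shrinking

/-- A convex set of continuous functions on a compact space which contains a bounded sequence
converging pointwise to a function bounded above by one contains a function smaller than two. -/
theorem exists_mem_forall_lt_two {K : Type*} [TopologicalSpace K] [CompactSpace K] [T2Space K]
    {S : Set C(K, ℝ)} (hS : Convex ℝ S) (h : ℕ → C(K, ℝ)) (hh : ∀ k, h k ∈ S) {B : ℝ}
    (hB : ∀ k x, |h k x| ≤ B) {l : K → ℝ} (hl : ∀ x, Tendsto (fun k => h k x) atTop (𝓝 (l x)))
    (hl1 : ∀ x, l x ≤ 1) : ∃ u ∈ S, ∀ x, u x < 2 := by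
  by_contra! hcon
  set U : Set C(K, ℝ) := {u | MapsTo u univ (Iio 2)} with hU
  have hUo : IsOpen U := ContinuousMap.isOpen_setOfPred_mapsTo isCompact_univ isOpen_Iio
  have hUc : Convex ℝ U := by
    intro u hu v hv s t hs ht hst x _
    exact convex_Iio (𝕜 := ℝ) (2 : ℝ) (hu (mem_univ x)) (hv (mem_univ x)) hs ht hst
  have hdisj : Disjoint U S := by
    rw [Set.disjoint_left]
    intro u hu huS
    obtain ⟨x, hx⟩ := hcon u huS
    exact absurd (hu (mem_univ x)) (not_lt.2 hx)
  obtain ⟨Φ, a, hΦU, hΦS⟩ := geometric_hahn_banach_open hUc hUo hS hdisj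
  have hpos : ∀ u : C(K, ℝ), (∀ x, 0 ≤ u x) → 0 ≤ Φ u := by
    intro u hu
    by_contra! hneg
    have hmem : -((|a| / (-Φ u)) • u) ∈ U := by
      intro x _
      have h1 : 0 ≤ |a| / (-Φ u) * u x :=
        mul_nonneg (div_nonneg (abs_nonneg a) (by linarith)) (hu x)
      change -(|a| / (-Φ u) * u x) < 2
      linarith
    have h2 := hΦU _ hmem
    rw [map_neg, map_smul, smul_eq_mul, div_mul_eq_mul_div, div_neg, neg_neg,
      mul_div_cancel_right₀ _ hneg.ne] at h2
    exact absurd h2 (not_lt.2 (le_abs_self a))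
  let _ : MeasurableSpace K := borel K
  have : BorelSpace K := ⟨rfl⟩
  let Φ' : CompactlySupportedContinuousMap K ℝ →ₚ[ℝ] ℝ := PositiveLinearMap.mk₀
    { toFun := fun u => Φ (u : C(K, ℝ))
      map_add' := fun u v => Φ.map_add (u : C(K, ℝ)) (v : C(K, ℝ))
      map_smul' := fun c u => Φ.map_smul c (u : C(K, ℝ)) }
    (fun u hu => hpos _ fun x => hu x)
  set μ := RealRMK.rieszMeasure Φ' with hμ
  have hintegral : ∀ u : C(K, ℝ), ∫ x, u x ∂μ = Φ u := fun u =>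
    RealRMK.integral_rieszMeasure Φ' (CompactlySupportedContinuousMap.continuousMapEquiv u)
  have hfin : MeasureTheory.IsFiniteMeasure μ := inferInstance
  have hlim : Tendsto (fun k => ∫ x, h k x ∂μ) atTop (𝓝 (∫ x, l x ∂μ)) :=
    MeasureTheory.tendsto_integral_of_dominated_convergence (fun _ => B)
      (fun k => (h k).continuous.aestronglyMeasurable) (MeasureTheory.integrable_const B)
      (fun k => Eventually.of_forall fun x => hB k x) (Eventually.of_forall hl)
  have hmeas : MeasureTheory.AEStronglyMeasurable l μ :=
    aestronglyMeasurable_of_tendsto_ae atTop (fun k => (h k).continuous.aestronglyMeasurable)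
      (Eventually.of_forall hl)
  have hlB : ∀ x, |l x| ≤ B := fun x =>
    le_of_tendsto' (hl x).abs fun k => hB k x
  have hle : ∫ x, l x ∂μ ≤ ∫ _x, (1 : ℝ) ∂μ :=
    MeasureTheory.integral_mono
      ((MeasureTheory.integrable_const B).mono' hmeas (Eventually.of_forall hlB))
      (MeasureTheory.integrable_const 1) hl1
  have hone : ∫ _x, (1 : ℝ) ∂μ = Φ 1 := hintegral 1
  have ha : a ≤ ∫ x, l x ∂μ := ge_of_tendsto' hlim fun k => by
    rw [hintegral]
    exact hΦS _ (hh k)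
  have h3 : Φ ((3 / 2 : ℝ) • (1 : C(K, ℝ))) < a := hΦU _ fun x _ => by
    change (3 / 2 : ℝ) * 1 < 2
    norm_num
  rw [map_smul, smul_eq_mul] at h3
  have h4 : 0 ≤ Φ 1 := hpos 1 fun x => zero_le_one
  linarith

theorem isCompact_weakDual_norm_le_one (E : Type*) [NormedAddCommGroup E] [NormedSpace ℝ E] :
    IsCompact {g : WeakDual ℝ E | ‖WeakDual.toStrongDual g‖ ≤ 1} := by
  convert WeakDual.isCompact_closedBall (𝕜 := ℝ) (E := E) 0 1 using 1
  ext g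
  exact mem_closedBall_zero_iff.symm

/-- The head projections have far convex combinations of norm at most two as soon as the basis is
shrinking. -/
theorem exists_convexHull_headProj_norm_le {X : Type*} [NormedAddCommGroup X] [NormedSpace ℝ X]
    {b : UnconditionalSchauderBasis ℕ ℝ X} {B : ℝ} (hB : IsBasisBound b B)
    (hshrink : ∀ (g : X →L[ℝ] ℝ) (c : ℝ), 0 < c →
      ∃ N, ∀ n, N ≤ n → ∀ r, headProj b n r = 0 → |g r| ≤ c * ‖r‖) (m : ℕ) :
    ∃ T ∈ convexHull ℝ (headProj b '' Ici m), ∀ x, ‖T x‖ ≤ 2 * ‖x‖ := by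
  have hB0 : 0 < B := by linarith [hB.one_le]
  have hlim : ∀ g : X →L[ℝ] ℝ, Tendsto (fun k => g.comp (headProj b k)) atTop (𝓝 g) := by
    intro g
    rw [Metric.tendsto_atTop]
    intro e he
    obtain ⟨N, hN⟩ := hshrink g (e / 2 / B) (by positivity)
    refine ⟨N, fun n hn => ?_⟩
    rw [dist_comm, dist_eq_norm]
    refine lt_of_le_of_lt (ContinuousLinearMap.opNorm_le_bound _ (half_pos he).le fun x => ?_)
      (half_lt_self he)
    rw [show (g - g.comp (headProj b n)) x = g (tailProj b n x) by simp [tailProj_apply],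
      Real.norm_eq_abs]
    refine (hN n hn _ (headProj_tailProj b n x)).trans ?_
    calc e / 2 / B * ‖tailProj b n x‖ ≤ e / 2 / B * (B * ‖x‖) := by
          gcongr
          exact hB.norm_tailProj_le n x
      _ = e / 2 * ‖x‖ := by field_simp
  let K₁ : Set (WeakDual ℝ X) := {g | ‖WeakDual.toStrongDual g‖ ≤ 1}
  let K₂ : Set (WeakDual ℝ (StrongDual ℝ X)) := {g | ‖WeakDual.toStrongDual g‖ ≤ 1}
  have : CompactSpace K₁ := isCompact_iff_compactSpace.1 (isCompact_weakDual_norm_le_one X)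
  have : CompactSpace K₂ :=
    isCompact_iff_compactSpace.1 (isCompact_weakDual_norm_le_one (StrongDual ℝ X))
  let pair : K₁ × K₂ → (X →L[ℝ] X) → ℝ := fun q T =>
    WeakDual.toStrongDual q.2.1 ((WeakDual.toStrongDual q.1.1).comp T)
  have hq₁ : ∀ q : K₁ × K₂, ‖WeakDual.toStrongDual q.1.1‖ ≤ 1 := fun q => q.1.2
  have hq₂ : ∀ q : K₁ × K₂, ‖WeakDual.toStrongDual q.2.1‖ ≤ 1 := fun q => q.2.2
  have hpair : ∀ k q, pair q (headProj b k) =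
      ∑ j ∈ Finset.range k, q.1.1 (b j) * q.2.1 (b.coord j) := by
    intro k q
    have : (WeakDual.toStrongDual q.1.1).comp (headProj b k) =
        ∑ j ∈ Finset.range k, q.1.1 (b j) • b.coord j := by
      ext x
      simp [headProj_apply, mul_comm]
    simp only [pair, this, map_sum, map_smul, smul_eq_mul]
    rfl
  have hcont : ∀ k, Continuous fun q => pair q (headProj b k) := by
    intro k
    simp only [hpair]
    refine continuous_finsetSum _ fun j _ => ?_
    exact ((WeakDual.eval_continuous (b j)).comp (continuous_subtype_val.comp continuous_fst)).mul
      ((WeakDual.eval_continuous (b.coord j)).comp (continuous_subtype_val.comp continuous_snd))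
  have hpairle : ∀ (q : K₁ × K₂) (g : X →L[ℝ] ℝ), |WeakDual.toStrongDual q.2.1 g| ≤ ‖g‖ := fun q g => by
    simpa using (WeakDual.toStrongDual q.2.1).le_of_opNorm_le (hq₂ q) g
  let S : Set C(K₁ × K₂, ℝ) :=
    {u | ∃ T ∈ convexHull ℝ (headProj b '' Ici m), ∀ q, u q = pair q T}
  have hS : Convex ℝ S := by
    rintro u ⟨T, hT, hu⟩ v ⟨T', hT', hv⟩ s t hs ht hst
    refine ⟨s • T + t • T', convex_convexHull ℝ _ hT hT' hs ht hst, fun q => ?_⟩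
    have e : (WeakDual.toStrongDual q.1.1).comp (s • T + t • T') =
        s • (WeakDual.toStrongDual q.1.1).comp T + t • (WeakDual.toStrongDual q.1.1).comp T' := by
      ext x
      simp
    change s * u q + t * v q = WeakDual.toStrongDual q.2.1
      ((WeakDual.toStrongDual q.1.1).comp (s • T + t • T'))
    rw [hu, hv, e, map_add, map_smul, map_smul]
    rfl
  obtain ⟨u, ⟨T, hT, hu⟩, hu2⟩ := exists_mem_forall_lt_two hS
    (fun k => ⟨fun q => pair q (headProj b (m + k)), hcont (m + k)⟩)
    (fun k => ⟨headProj b (m + k),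
      subset_convexHull ℝ _ (mem_image_of_mem _ (Nat.le_add_right m k)), fun q => rfl⟩)
    (B := B) (l := fun q : K₁ × K₂ => WeakDual.toStrongDual q.2.1 (WeakDual.toStrongDual q.1.1))
    (fun k q => by
      refine (hpairle q _).trans (ContinuousLinearMap.opNorm_le_bound _ hB0.le fun x => ?_)
      have := (WeakDual.toStrongDual q.1.1).le_of_opNorm_le (hq₁ q) (headProj b (m + k) x)
      rw [one_mul] at this
      exact this.trans (hB.norm_headProj_le _ _))
    (fun q => by
      have h1 := (hlim (WeakDual.toStrongDual q.1.1)).comp (tendsto_add_atTop_nat m)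
      have h2 := ((WeakDual.toStrongDual q.2.1).continuous.tendsto _).comp h1
      refine h2.congr fun k => ?_
      simp only [comp_apply, add_comm k m]
      rfl)
    (fun q => (le_abs_self _).trans ((hpairle q _).trans (hq₁ q)))
  refine ⟨T, hT, fun x => ?_⟩
  rcases eq_or_ne x 0 with rfl | hx
  · simp
  have hx0 : 0 < ‖x‖ := norm_pos_iff.2 hx
  obtain ⟨g, hg, hgx⟩ := exists_dual_vector'' ℝ (T x)
  let G : StrongDual ℝ (StrongDual ℝ X) :=
    NormedSpace.inclusionInDoubleDual ℝ X (‖x‖⁻¹ • x)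
  have hG : ‖G‖ ≤ 1 := by
    refine (NormedSpace.double_dual_bound ℝ X _).trans ?_
    rw [norm_smul, norm_inv, norm_norm, inv_mul_cancel₀ hx0.ne']
  have := hu2 ⟨⟨StrongDual.toWeakDual g, hg⟩,
    ⟨StrongDual.toWeakDual G, hG⟩⟩
  rw [hu] at this
  change g (T (‖x‖⁻¹ • x)) < 2 at this
  rw [map_smul, map_smul, hgx, smul_eq_mul, inv_mul_eq_div, div_lt_iff₀ hx0] at this
  exact this.le

theorem exists_contDiff_approx_of_finiteDimensional {E Z : Type*} [NormedAddCommGroup E]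
    [NormedSpace ℝ E] [FiniteDimensional ℝ E] [NormedAddCommGroup Z] [NormedSpace ℝ Z]
    [CompleteSpace Z] {f : E → Z} {η : ℝ} (hη : 0 ≤ η)
    (hf : ∀ x y, ‖f x - f y‖ ≤ η * ‖x - y‖) {e : ℝ} (he : 0 < e) (p : ℕ∞) :
    ∃ F : E → Z, ContDiff ℝ p F ∧ (∀ x, ‖F x - f x‖ ≤ e) ∧
      ∀ x y, ‖F x - F y‖ ≤ η * ‖x - y‖ := by
  let _ : MeasurableSpace E := borel E
  have : BorelSpace E := ⟨rfl⟩
  let μ : MeasureTheory.Measure E := MeasureTheory.Measure.addHaar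
  have hfc : Continuous f := by
    refine (LipschitzWith.of_dist_le_mul (K := ⟨η, hη⟩) fun x y => ?_).continuous
    rw [dist_eq_norm, dist_eq_norm]
    exact hf x y
  let φ : ContDiffBump (0 : E) :=
    ⟨e / (η + 1) / 2, e / (η + 1), by positivity, half_lt_self (by positivity)⟩
  have hle : η * (e / (η + 1)) ≤ e := by
    rw [mul_div_assoc', div_le_iff₀ (by positivity)]
    nlinarith
  have hloc : MeasureTheory.LocallyIntegrable f μ := hfc.locallyIntegrable
  have hex := φ.hasCompactSupport_normed.convolutionExists_left
    (ContinuousLinearMap.lsmul ℝ ℝ : ℝ →L[ℝ] Z →L[ℝ] Z) (φ.continuous_normed (μ := μ)) hloc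
  refine ⟨MeasureTheory.convolution (φ.normed μ) f (ContinuousLinearMap.lsmul ℝ ℝ) μ,
    φ.hasCompactSupport_normed.contDiff_convolution_left _ φ.contDiff_normed hloc,
    fun x => ?_, fun x y => ?_⟩
  · rw [← dist_eq_norm]
    refine φ.dist_normed_convolution_le hfc.aestronglyMeasurable fun z hz => ?_
    rw [dist_eq_norm]
    refine (hf z x).trans (le_trans ?_ hle)
    rw [Metric.mem_ball, dist_eq_norm] at hz
    gcongr
  · rw [MeasureTheory.convolution_def, MeasureTheory.convolution_def,
      ← MeasureTheory.integral_sub (hex x) (hex y)]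
    have hone : ∫ t, φ.normed μ t * (η * ‖x - y‖) ∂μ = η * ‖x - y‖ := by
      rw [MeasureTheory.integral_mul_const, φ.integral_normed, one_mul]
    rw [← hone]
    refine MeasureTheory.norm_integral_le_of_norm_le (φ.integrable_normed.mul_const _)
      (Eventually.of_forall fun t => ?_)
    simp only [ContinuousLinearMap.lsmul_apply]
    rw [← smul_sub, norm_smul, Real.norm_of_nonneg (φ.nonneg_normed t)]
    refine mul_le_mul_of_nonneg_left ?_ (φ.nonneg_normed t)
    have := hf (x - t) (y - t)
    rwa [sub_sub_sub_cancel_right] at this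

theorem exists_contDiff_approx_on_range_headProj {X Z : Type*} [NormedAddCommGroup X]
    [NormedSpace ℝ X] [NormedAddCommGroup Z] [NormedSpace ℝ Z] [CompleteSpace Z]
    (b : UnconditionalSchauderBasis ℕ ℝ X) (n : ℕ) {f : X → Z} {η : ℝ} (hη : 0 ≤ η)
    (hf : ∀ x y, ‖f x - f y‖ ≤ η * ‖x - y‖) {e : ℝ} (he : 0 < e) (p : ℕ∞) :
    ∃ F : X → Z, ContDiff ℝ p F ∧ (∀ x, headProj b n x = x → ‖F x - f x‖ ≤ e) ∧
      ∀ x y, headProj b n x = x → headProj b n y = y → ‖F x - F y‖ ≤ η * ‖x - y‖ := by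
  obtain ⟨F, hF, hFf, hFl⟩ := exists_contDiff_approx_of_finiteDimensional
    (f := fun v : LinearMap.range (headProj b n : X →ₗ[ℝ] X) => f v) hη
    (fun x y => hf x y) he p
  let π : X →L[ℝ] LinearMap.range (headProj b n : X →ₗ[ℝ] X) :=
    (headProj b n).codRestrict _ fun x => ⟨x, rfl⟩
  have hπ : ∀ x, (π x : X) = headProj b n x := fun x => rfl
  refine ⟨F ∘ π, hF.comp π.contDiff, fun x hx => ?_, fun x y hx hy => ?_⟩
  · have := hFf (π x)
    rwa [hπ, hx] at this
  · have := hFl (π x) (π y)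
    change _ ≤ η * ‖(π x : X) - π y‖ at this
    rwa [hπ, hπ, hx, hy] at this

theorem exists_lipschitz_mul_prod {X : Type*} [NormedAddCommGroup X] {ψ : ℕ → X → ℝ}
    (h0 : ∀ k x, 0 ≤ ψ k x) (h1 : ∀ k x, ψ k x ≤ 1)
    (hlip : ∀ k, ∃ c, 0 ≤ c ∧ ∀ x y, |ψ k x - ψ k y| ≤ c * ‖x - y‖) (k : ℕ) :
    ∃ c, 0 ≤ c ∧ ∀ x y, |ψ k x * ∏ i ∈ Finset.range k, (1 - ψ i x) -
      ψ k y * ∏ i ∈ Finset.range k, (1 - ψ i y)| ≤ c * ‖x - y‖ := by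
  have hmul : ∀ a a' u u' : ℝ, 0 ≤ a → a ≤ 1 → 0 ≤ u' → u' ≤ 1 →
      |a * u - a' * u'| ≤ |a - a'| + |u - u'| := by
    intro a a' u u' ha ha1 hu hu1
    rw [show a * u - a' * u' = (a - a') * u' + a * (u - u') by ring]
    refine (abs_add_le _ _).trans (add_le_add ?_ ?_)
    · rw [abs_mul, abs_of_nonneg hu]
      exact mul_le_of_le_one_right (abs_nonneg _) hu1
    · rw [abs_mul, abs_of_nonneg ha]
      exact mul_le_of_le_one_left (abs_nonneg _) ha1
  have hP0 : ∀ n x, 0 ≤ ∏ i ∈ Finset.range n, (1 - ψ i x) := fun n x =>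
    Finset.prod_nonneg fun i _ => by linarith [h1 i x]
  have hP1 : ∀ n x, ∏ i ∈ Finset.range n, (1 - ψ i x) ≤ 1 := fun n x =>
    Finset.prod_le_one (fun i _ => by linarith [h1 i x]) fun i _ => by linarith [h0 i x]
  have hP : ∀ n, ∃ c, 0 ≤ c ∧ ∀ x y, |∏ i ∈ Finset.range n, (1 - ψ i x) -
      ∏ i ∈ Finset.range n, (1 - ψ i y)| ≤ c * ‖x - y‖ := by
    intro n
    induction n with
    | zero => exact ⟨0, le_rfl, by simp⟩
    | succ n ih =>
      obtain ⟨c, hc, h⟩ := ih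
      obtain ⟨c', hc', h'⟩ := hlip n
      refine ⟨c + c', by positivity, fun x y => ?_⟩
      rw [Finset.prod_range_succ, Finset.prod_range_succ]
      refine (hmul _ _ _ _ (hP0 n x) (hP1 n x) (by linarith [h1 n y])
        (by linarith [h0 n y])).trans ?_
      have h2 := h' y x
      rw [norm_sub_rev] at h2
      rw [show 1 - ψ n x - (1 - ψ n y) = ψ n y - ψ n x by ring, add_mul]
      exact add_le_add (h x y) h2
  obtain ⟨c, hc, h⟩ := hP k
  obtain ⟨c', hc', h'⟩ := hlip k
  refine ⟨c' + c, by positivity, fun x y => ?_⟩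
  rw [add_mul]
  exact (hmul _ _ _ _ (h0 k x) (h1 k x) (hP0 k y) (hP1 k y)).trans (add_le_add (h' x y) (h x y))

theorem sum_mul_prod_one_sub (u : ℕ → ℝ) (n : ℕ) :
    ∑ k ∈ Finset.range n, u k * ∏ i ∈ Finset.range k, (1 - u i) =
      1 - ∏ i ∈ Finset.range n, (1 - u i) := by
  induction n with
  | zero => simp
  | succ n ih =>
    rw [Finset.sum_range_succ, Finset.prod_range_succ, ih]
    ring

section Gluing

variable {X Z : Type*} [NormedAddCommGroup X] [NormedSpace ℝ X] [NormedAddCommGroup Z]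
  [NormedSpace ℝ Z]

/-- On `U`, the map `g` can be approximated by `C^p`-smooth maps which are locally Lipschitz with a
constant arbitrarily close to `L`. -/
def HasLipschitzSmoothApprox (p : ℕ∞) (U : Set X) (g : X → Z) (L : ℝ) : Prop :=
  ∀ e > 0, ∀ d > 0, ∃ K : X → Z, ∀ x ∈ U, ContDiffAt ℝ p K x ∧ ‖K x - g x‖ ≤ e ∧
    ∀ᶠ y in 𝓝 x, ‖K y - K x‖ ≤ (L + d) * ‖y - x‖

theorem HasLipschitzSmoothApprox.glue {p : ℕ∞} {U : Set X} {V : ℕ → Set X} {g : X → Z} {L : ℝ}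
    {ψ : ℕ → X → ℝ} (hψ : ∀ k, ContDiff ℝ p (ψ k)) (h0 : ∀ k x, 0 ≤ ψ k x)
    (h1 : ∀ k x, ψ k x ≤ 1) (hlip : ∀ k, ∃ c, 0 ≤ c ∧ ∀ x y, |ψ k x - ψ k y| ≤ c * ‖x - y‖)
    (hone : ∀ x ∈ U, ∃ N, ∀ᶠ y in 𝓝 x, ψ N y = 1)
    (hzero : ∀ k, ∀ x ∈ U, x ∉ V k → ∀ᶠ y in 𝓝 x, ψ k y = 0)
    (hV : ∀ k, HasLipschitzSmoothApprox p (V k) g L) : HasLipschitzSmoothApprox p U g L := by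
  intro e he d hd
  choose c hc hcφ using exists_lipschitz_mul_prod h0 h1 hlip
  set φ : ℕ → X → ℝ := fun k x => ψ k x * ∏ i ∈ Finset.range k, (1 - ψ i x) with hφ
  have hφ0 : ∀ k x, 0 ≤ φ k x := fun k x =>
    mul_nonneg (h0 k x) (Finset.prod_nonneg fun i _ => by linarith [h1 i x])
  have hφd : ∀ k, ContDiff ℝ p (φ k) := fun k =>
    (hψ k).mul (contDiff_prod fun i _ => contDiff_const.sub (hψ i))
  set ε : ℕ → ℝ := fun k => min e (d / 2 * (1 / 2) ^ (k + 1) / (c k + 1)) with hε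
  have hεpos : ∀ k, 0 < ε k := fun k => by
    have := hc k
    exact lt_min he (by positivity)
  have hcε : ∀ k, c k * ε k ≤ d / 2 * (1 / 2) ^ (k + 1) := fun k => by
    have h := hc k
    calc c k * ε k ≤ (c k + 1) * (d / 2 * (1 / 2) ^ (k + 1) / (c k + 1)) :=
          mul_le_mul (by linarith) (min_le_right _ _) (hεpos k).le (by linarith)
      _ = _ := mul_div_cancel₀ _ (by linarith)
  choose G hG using fun k => hV k (ε k) (hεpos k) (d / 2) (half_pos hd)
  have hfin : ∀ N y, ψ N y = 1 → (∀ k, N < k → φ k y = 0) ∧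
      ∑ k ∈ Finset.range (N + 1), φ k y = 1 := by
    intro N y hy
    have hp : ∀ k, N < k → ∏ i ∈ Finset.range k, (1 - ψ i y) = 0 := fun k hk =>
      Finset.prod_eq_zero (Finset.mem_range.2 hk) (by rw [hy, sub_self])
    refine ⟨fun k hk => ?_, ?_⟩
    · simp only [hφ, hp k hk, mul_zero]
    · rw [sum_mul_prod_one_sub (fun k => ψ k y), hp _ (Nat.lt_succ_self N), sub_zero]
  set K : X → Z := fun x => ∑' k, φ k x • G k x with hK
  have hKsum : ∀ N y, ψ N y = 1 → K y = ∑ k ∈ Finset.range (N + 1), φ k y • G k y := by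
    intro N y hy
    refine tsum_eq_sum fun k hk => ?_
    rw [(hfin N y hy).1 k (by simpa using hk), zero_smul]
  have hφzero : ∀ k, ∀ x ∈ U, x ∉ V k → ∀ᶠ y in 𝓝 x, φ k y = 0 := fun k x hx hxk =>
    (hzero k x hx hxk).mono fun y hy => by simp only [hφ, hy, zero_mul]
  refine ⟨K, fun x hx => ?_⟩
  obtain ⟨N, hN⟩ := hone x hx
  have hNx := hN.self_of_nhds
  refine ⟨?_, ?_, ?_⟩
  · refine ContDiffAt.congr_of_eventuallyEq ?_ (hN.mono fun y hy => hKsum N y hy)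
    refine ContDiffAt.sum fun k _ => ?_
    by_cases hxk : x ∈ V k
    · exact (hφd k).contDiffAt.smul (hG k x hxk).1
    · refine (contDiffAt_const (c := (0 : Z))).congr_of_eventuallyEq ?_
      filter_upwards [hφzero k x hx hxk] with y hy
      rw [hy, zero_smul]
  · have e1 : K x - g x = ∑ k ∈ Finset.range (N + 1), φ k x • (G k x - g x) := by
      simp only [smul_sub, Finset.sum_sub_distrib]
      rw [hKsum N x hNx, ← Finset.sum_smul, (hfin N x hNx).2, one_smul]
    rw [e1]
    calc _ ≤ ∑ k ∈ Finset.range (N + 1), φ k x * e := by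
          refine norm_sum_le_of_le _ fun k _ => ?_
          rw [norm_smul, Real.norm_of_nonneg (hφ0 k x)]
          by_cases hxk : x ∈ V k
          · exact mul_le_mul_of_nonneg_left ((hG k x hxk).2.1.trans (min_le_left _ _)) (hφ0 k x)
          · rw [(hφzero k x hx hxk).self_of_nhds, zero_mul, zero_mul]
      _ = e := by rw [← Finset.sum_mul, (hfin N x hNx).2, one_mul]
  · have hev : ∀ᶠ y in 𝓝 x, ∀ k ∈ Finset.range (N + 1),
        ‖φ k y • (G k y - G k x) + (φ k y - φ k x) • (G k x - g x)‖ ≤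
          φ k y * ((L + d / 2) * ‖y - x‖) + d / 2 * (1 / 2) ^ (k + 1) * ‖y - x‖ := by
      rw [Finset.eventually_all]
      intro k _
      by_cases hxk : x ∈ V k
      · filter_upwards [(hG k x hxk).2.2] with y hy
        refine (norm_add_le _ _).trans (add_le_add ?_ ?_)
        · rw [norm_smul, Real.norm_of_nonneg (hφ0 k y)]
          exact mul_le_mul_of_nonneg_left hy (hφ0 k y)
        · rw [norm_smul, Real.norm_eq_abs]
          calc _ ≤ c k * ‖y - x‖ * ε k :=
                mul_le_mul (hcφ k y x) (hG k x hxk).2.1 (norm_nonneg _)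
                  (mul_nonneg (hc k) (norm_nonneg _))
            _ = c k * ε k * ‖y - x‖ := by ring
            _ ≤ _ := mul_le_mul_of_nonneg_right (hcε k) (norm_nonneg _)
      · filter_upwards [hφzero k x hx hxk] with y hy
        rw [hy, (hφzero k x hx hxk).self_of_nhds, sub_self, zero_smul, zero_smul, add_zero,
          norm_zero, zero_mul, zero_add]
        positivity
    filter_upwards [hN, hev] with y hNy hy
    have e1 : K y - K x = ∑ k ∈ Finset.range (N + 1),
        (φ k y • (G k y - G k x) + (φ k y - φ k x) • (G k x - g x)) := by
      have e2 : ∑ k ∈ Finset.range (N + 1), (φ k y - φ k x) • g x = 0 := by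
        rw [← Finset.sum_smul, Finset.sum_sub_distrib, (hfin N x hNx).2, (hfin N y hNy).2,
          sub_self, zero_smul]
      rw [hKsum N x hNx, hKsum N y hNy, ← sub_zero (_ - _), ← e2, ← Finset.sum_sub_distrib,
        ← Finset.sum_sub_distrib]
      refine Finset.sum_congr rfl fun k _ => ?_
      simp only [smul_sub, sub_smul]
      abel
    have hgeo : ∑ k ∈ Finset.range (N + 1), (1 / 2 : ℝ) ^ (k + 1) ≤ 1 := by
      have : ∀ n : ℕ, ∑ k ∈ Finset.range n, (1 / 2 : ℝ) ^ (k + 1) = 1 - (1 / 2) ^ n := by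
        intro n
        induction n with
        | zero => simp
        | succ n ih =>
          rw [Finset.sum_range_succ, ih]
          ring
      rw [this]
      have : (0 : ℝ) ≤ (1 / 2) ^ (N + 1) := by positivity
      linarith
    rw [e1]
    refine (norm_sum_le_of_le _ hy).trans ?_
    rw [Finset.sum_add_distrib, ← Finset.sum_mul, (hfin N y hNy).2, ← Finset.sum_mul,
      ← Finset.mul_sum]
    have : d / 2 * ∑ k ∈ Finset.range (N + 1), (1 / 2 : ℝ) ^ (k + 1) ≤ d / 2 :=
      mul_le_of_le_one_right (half_pos hd).le hgeo
    nlinarith [norm_nonneg (y - x)]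

end Gluing

section Smoothing

variable {X Z : Type*} [NormedAddCommGroup X] [NormedSpace ℝ X] [NormedAddCommGroup Z]
  [NormedSpace ℝ Z] {b : UnconditionalSchauderBasis ℕ ℝ X}

theorem HasLipschitzSmoothApprox.of_tail {p : ℕ∞} {H : X → ℝ} {R Λ : ℝ}
    (hH : IsSmoothCutoff p H R Λ) {U : Set X} {g : X → Z} {L κ : ℝ} (hκ : 0 < κ) (N : ℕ)
    (hU : ∀ k, HasLipschitzSmoothApprox p (U ∩ {x | ‖tailProj b (N + k) x‖ < κ}) g L) :
    HasLipschitzSmoothApprox p U g L := by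
  have hR := hH.one_le_radius
  set c : ℝ := (R + 1) / κ with hc
  have hc0 : 0 < c := by positivity
  have hnorm : ∀ v : X, ‖c • v‖ = c * ‖v‖ := fun v => by
    rw [norm_smul, Real.norm_of_nonneg hc0.le]
  have hcont : ∀ k, Continuous fun y => ‖c • tailProj b (N + k) y‖ := fun k =>
    ((tailProj b (N + k)).continuous.const_smul c).norm
  refine HasLipschitzSmoothApprox.glue
    (ψ := fun k x => 1 - H (c • tailProj b (N + k) x)) (fun k => ?_) (fun k x => ?_)
    (fun k x => ?_) (fun k => ?_) (fun x _ => ?_) (fun k x hx hxk => ?_) hU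
  · exact contDiff_const.sub (hH.contDiff.comp ((tailProj b (N + k)).contDiff.const_smul c))
  · linarith [hH.le_one (c • tailProj b (N + k) x)]
  · linarith [hH.nonneg (c • tailProj b (N + k) x)]
  · refine ⟨Λ * (c * ‖tailProj b (N + k)‖),
      mul_nonneg hH.nonneg_const (mul_nonneg hc0.le (norm_nonneg _)), fun x y => ?_⟩
    rw [show ∀ u v : ℝ, 1 - u - (1 - v) = -(u - v) by intros; ring, abs_neg]
    refine (hH.abs_sub_le _ _).trans ?_
    rw [← smul_sub, ← map_sub, hnorm, mul_assoc, mul_assoc]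
    exact mul_le_mul_of_nonneg_left (mul_le_mul_of_nonneg_left
      ((tailProj b (N + k)).le_opNorm _) hc0.le) hH.nonneg_const
  · have h1 : Tendsto (fun k => ‖c • tailProj b (N + k) x‖) atTop (𝓝 0) := by
      have h := ((tendsto_tailProj b x).comp (tendsto_add_atTop_nat N)).const_smul c |>.norm
      rw [smul_zero, norm_zero] at h
      refine h.congr fun k => ?_
      simp only [comp_apply, add_comm k N]
    obtain ⟨k, hk⟩ := (h1.eventually (gt_mem_nhds one_pos)).exists
    refine ⟨k, ((hcont k).continuousAt.eventually (gt_mem_nhds hk)).mono fun y hy => ?_⟩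
    rw [hH.eq_zero _ hy.le, sub_zero]
  · have h1 : κ ≤ ‖tailProj b (N + k) x‖ := not_lt.1 fun h => hxk ⟨hx, h⟩
    have h2 : R < ‖c • tailProj b (N + k) x‖ := by
      rw [hnorm]
      calc R < R + 1 := lt_add_one R
        _ = c * κ := by rw [hc, div_mul_cancel₀ _ hκ.ne']
        _ ≤ _ := by gcongr
    refine ((hcont k).continuousAt.eventually (lt_mem_nhds h2)).mono fun y hy => ?_
    rw [hH.eq_one _ hy.le, sub_self]

theorem exists_smooth_near_identity [CompleteSpace X] {B : ℝ} (hB : IsBasisBound b B)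
    {p : ℕ∞} (hp : 1 ≤ p) {H : X → ℝ} {R Λ : ℝ} (hH : IsSmoothCutoff p H R Λ) :
    ∃ a D : ℝ, 0 ≤ a ∧ 0 ≤ D ∧ ∀ m, ∃ (T : X →L[ℝ] X) (N : ℕ), (∀ x, ‖T x‖ ≤ 2 * ‖x‖) ∧
      (∀ n, N ≤ n → ∀ x, headProj b n (T x) = T x) ∧
      ∀ ε > 0, ∃ (Ψ : X → X) (κ : ℝ), 0 < κ ∧ ContDiff ℝ p Ψ ∧ (∀ x, ‖Ψ x - x‖ ≤ D * ε) ∧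
        (∀ x x', headProj b m (Ψ x - Ψ x' - T (x - x')) = 0) ∧
        (∀ x x', ‖Ψ x - Ψ x' - T (x - x')‖ ≤ a * ‖x - x'‖) ∧
        ∀ n, N ≤ n → ∀ x, ‖tailProj b n x‖ < κ → headProj b n (Ψ x) = Ψ x := by
  have hB0 : 0 < B := by linarith [hB.one_le]
  obtain ⟨Φ, D, C, κ, hκ, hD, hC, hΦ, hΦD, hΦC, hΦκ⟩ := exists_smooth_locally_head_approx hB hH
  refine ⟨B * (C * 3), B * D, by positivity, by positivity, fun m => ?_⟩
  obtain ⟨T, hT, hT2⟩ := exists_convexHull_headProj_norm_le hB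
    (fun g c hc => exists_abs_le_of_headProj_eq_zero hB hp hH g hc) m
  have hTm : ∀ x, headProj b m (T x) = headProj b m x := by
    have : convexHull ℝ (headProj b '' Ici m) ⊆
        {S : X →L[ℝ] X | ∀ x, headProj b m (S x) = headProj b m x} := by
      refine convexHull_min ?_ ?_
      · rintro _ ⟨k, hk, rfl⟩ x
        rw [headProj_headProj, min_eq_left hk]
      · intro S hS S' hS' s t _ _ hst x
        simp only [add_apply, smul_apply, map_add, map_smul, hS x, hS' x]
        rw [← add_smul, hst, one_smul]
    exact this hT
  obtain ⟨N, hN⟩ : ∃ N, ∀ n, N ≤ n → ∀ x, headProj b n (T x) = T x := by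
    have : convexHull ℝ (headProj b '' Ici m) ⊆
        {S : X →L[ℝ] X | ∃ N, ∀ n, N ≤ n → ∀ x, headProj b n (S x) = S x} := by
      refine convexHull_min ?_ ?_
      · rintro _ ⟨k, _, rfl⟩
        exact ⟨k, fun n hn x => headProj_headProj_of_le b hn x⟩
      · rintro S ⟨N, hN⟩ S' ⟨N', hN'⟩ s t _ _ _
        refine ⟨max N N', fun n hn x => ?_⟩
        simp only [add_apply, smul_apply, map_add, map_smul,
          hN n (le_of_max_le_left hn) x, hN' n (le_of_max_le_right hn) x]
    exact this hT
  refine ⟨T, N, hT2, hN, fun ε hε => ?_⟩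
  set Ψ : X → X := fun x => T x + tailProj b m (ε • Φ (ε⁻¹ • (x - T x))) with hΨ
  have hdiff : ∀ x x', Ψ x - Ψ x' - T (x - x') =
      tailProj b m (ε • (Φ (ε⁻¹ • (x - T x)) - Φ (ε⁻¹ • (x' - T x')))) := by
    intro x x'
    simp only [hΨ, map_sub, smul_sub]
    abel
  refine ⟨Ψ, κ * ε, by positivity, ?_, fun x => ?_, fun x x' => ?_, fun x x' => ?_,
    fun n hn x hx => ?_⟩
  · exact T.contDiff.add ((tailProj b m).contDiff.comp
      ((hΦ.comp ((contDiff_id.sub T.contDiff).const_smul ε⁻¹)).const_smul ε))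
  · have h1 : tailProj b m (x - T x) = x - T x :=
      tailProj_eq_self b (by rw [map_sub, hTm, sub_self])
    have h2 : Ψ x - x =
        tailProj b m (ε • (Φ (ε⁻¹ • (x - T x)) - ε⁻¹ • (x - T x))) := by
      rw [smul_sub, smul_inv_smul₀ hε.ne', map_sub, h1]
      simp only [hΨ]
      abel
    rw [h2]
    refine (hB.norm_tailProj_le _ _).trans ?_
    rw [norm_smul, Real.norm_of_nonneg hε.le]
    calc _ ≤ B * (ε * D) := by
          gcongr
          exact hΦD _
      _ = _ := by ring
  · rw [hdiff, headProj_tailProj]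
  · rw [hdiff]
    refine (hB.norm_tailProj_le _ _).trans ?_
    rw [mul_assoc]
    refine mul_le_mul_of_nonneg_left ?_ hB0.le
    rw [norm_smul, Real.norm_of_nonneg hε.le]
    have h1 := hΦC (ε⁻¹ • (x - T x)) (ε⁻¹ • (x' - T x'))
    rw [← smul_sub, norm_smul, norm_inv, Real.norm_of_nonneg hε.le] at h1
    have h2 : ‖x - T x - (x' - T x')‖ ≤ 3 * ‖x - x'‖ := by
      rw [show x - T x - (x' - T x') = (x - x') - T (x - x') by rw [map_sub]; abel]
      have := norm_sub_le (x - x') (T (x - x'))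
      linarith [hT2 (x - x')]
    calc _ ≤ ε * (C * (ε⁻¹ * (3 * ‖x - x'‖))) := by
          refine mul_le_mul_of_nonneg_left (h1.trans ?_) hε.le
          gcongr
      _ = _ := by field_simp
  · have h1 : ‖tailProj b n (ε⁻¹ • (x - T x))‖ < κ := by
      rw [map_smul, map_sub, tailProj_apply b n (T x), hN n hn, sub_self, sub_zero, norm_smul,
        norm_inv, Real.norm_of_nonneg hε.le, inv_mul_lt_iff₀ hε, mul_comm]
      exact hx
    simp only [hΨ]
    rw [map_add, hN n hn, headProj_tailProj_comm, map_smul, hΦκ n _ h1]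

theorem isCompact_block (b : UnconditionalSchauderBasis ℕ ℝ X) (m n : ℕ) (a : ℝ) :
    IsCompact {r : X | headProj b n r = r ∧ headProj b m r = 0 ∧ ‖r‖ ≤ a} := by
  have h1 : IsCompact ((Subtype.val : LinearMap.range (headProj b n : X →ₗ[ℝ] X) → X) ''
      Metric.closedBall 0 a) :=
    (isCompact_closedBall 0 a).image continuous_subtype_val
  refine h1.of_isClosed_subset ?_ ?_
  · exact (isClosed_eq (headProj b n).continuous continuous_id).inter
      ((isClosed_eq (headProj b m).continuous continuous_const).inter
        (isClosed_le continuous_norm continuous_const))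
  · rintro r ⟨hr, -, hra⟩
    exact ⟨⟨r, r, hr⟩, mem_closedBall_zero_iff.2 hra, rfl⟩

end Smoothing

section Obstruction

variable {X Z : Type*} [NormedAddCommGroup X] [NormedSpace ℝ X] [NormedAddCommGroup Z]
  [NormedSpace ℝ Z] {b : UnconditionalSchauderBasis ℕ ℝ X}

/-- `A` is a smooth map on `U` into a finite dimensional space whose increments are, up to an error
of relative size `2 * (1 - s)`, given by the compact set `Y` of small potential, while
`x ↦ f (A x + s • x)` cannot be smoothly approximated on `U`. -/
structure IsObstruction (b : UnconditionalSchauderBasis ℕ ℝ X) (p : ℕ∞) (φ : X → ℝ) (f : X → Z)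
    (L : ℝ) (Y : Set X) (s : ℝ) : Prop where
  isCompact : IsCompact Y
  nonneg : 0 ≤ s
  potential_le : ∀ y ∈ Y, φ y ≤ (1 - s) / 2
  exists_map : ∃ (U : Set X) (A : X → X) (n : ℕ), IsOpen U ∧ (∀ x ∈ U, ContDiffAt ℝ p A x) ∧
    (∀ x ∈ U, headProj b n (A x) = A x) ∧
    (∀ x ∈ U, ∀ x' ∈ U, ∃ a, ∃ y ∈ Y, A x - A x' = a + ‖x - x'‖ • y ∧
      ‖a‖ ≤ 2 * (1 - s) * ‖x - x'‖) ∧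
    ¬ HasLipschitzSmoothApprox p U (fun x => f (A x + s • x)) L

variable {p : ℕ∞} {φ : X → ℝ} {f : X → Z} {η : ℝ} {Y : Set X} {s : ℝ}

theorem IsObstruction.pos [CompleteSpace Z] (hη : 0 ≤ η) (hf : ∀ x y, ‖f x - f y‖ ≤ η * ‖x - y‖)
    (hφ : ∀ y, φ y ≤ 1 / 2 → ‖y‖ ≤ 1) (h : IsObstruction b p φ f (3 * η) Y s) : 0 < s := by
  rcases h.nonneg.eq_or_lt with rfl | h0
  swap
  · exact h0
  obtain ⟨U, A, n, hU, hA, hAn, hAd, hbad⟩ := h.exists_map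
  refine absurd (fun e he d hd => ?_) hbad
  obtain ⟨F, hF, hFf, hFl⟩ := exists_contDiff_approx_on_range_headProj b n hη hf he p
  refine ⟨F ∘ A, fun x hx => ⟨hF.contDiffAt.comp x (hA x hx), ?_, ?_⟩⟩
  · change ‖F (A x) - f (A x + (0 : ℝ) • x)‖ ≤ e
    rw [zero_smul, add_zero]
    exact hFf _ (hAn x hx)
  · filter_upwards [hU.mem_nhds hx] with y hy
    obtain ⟨a, v, hv, hav, ha⟩ := hAd y hy x hx
    have hv1 : ‖v‖ ≤ 1 := hφ v (by simpa using h.potential_le v hv)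
    have h1 : ‖A y - A x‖ ≤ 3 * ‖y - x‖ := by
      rw [hav]
      refine (norm_add_le _ _).trans ?_
      rw [norm_smul, norm_norm]
      nlinarith [norm_nonneg (y - x)]
    refine (hFl _ _ (hAn y hy) (hAn x hx)).trans ?_
    nlinarith [norm_nonneg (y - x)]

theorem exists_uniform_obstruction_step [CompleteSpace X] {B : ℝ} (hB : IsBasisBound b B)
    (hp : 1 ≤ p) {H : X → ℝ} {R Λ : ℝ} (hH : IsSmoothCutoff p H R Λ) (hφ : ContDiff ℝ 1 φ)
    (hη : 0 ≤ η) (hf : ∀ x y, ‖f x - f y‖ ≤ η * ‖x - y‖) :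
    ∃ c, 0 ≤ c ∧ ∀ C : Set X, IsCompact C → ∃ w₀ > 0, ∀ L Y s, IsObstruction b p φ f L Y s →
      Y ⊆ C → ∀ w, 0 < w → w ≤ w₀ → w ≤ s →
        ∃ Y', IsObstruction b p φ f L Y' (s - w) ∧ ∀ y' ∈ Y', ∃ y ∈ Y, ‖y' - y‖ ≤ c * w := by
  obtain ⟨c, D, hc, hD, hstep⟩ := exists_smooth_near_identity hB hp hH
  refine ⟨c, hc, fun C hC => ?_⟩
  obtain ⟨w₀, hw₀, m, hm⟩ := exists_uniform_tail_bound hB hp hH hφ hC hc one_half_pos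
  obtain ⟨T, N, hT, hTN, hΨ⟩ := hstep m
  refine ⟨w₀, hw₀, fun L Y s h hYC w hw hww hws => ?_⟩
  obtain ⟨U, A, n, hU, hA, hAn, hAd, hbad⟩ := h.exists_map
  unfold HasLipschitzSmoothApprox at hbad
  push Not at hbad
  obtain ⟨e, he, d, hd, hbad⟩ := hbad
  obtain ⟨Ψ, κ, hκ, hΨp, hΨD, hΨm, hΨc, hΨN⟩ := hΨ (e / 2 / (η * w * D + 1)) (by positivity)
  set A' : X → X := fun x => A x + w • Ψ x with hA'
  have hclose : ∀ x, ‖f (A' x + (s - w) • x) - f (A x + s • x)‖ ≤ e / 2 := by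
    intro x
    refine (hf _ _).trans ?_
    rw [show A' x + (s - w) • x - (A x + s • x) = w • (Ψ x - x) by
      simp only [hA', sub_smul, smul_sub]; abel, norm_smul, Real.norm_of_nonneg hw.le]
    calc _ ≤ η * (w * (D * (e / 2 / (η * w * D + 1)))) := by
          gcongr
          exact hΨD x
      _ = η * w * D * (e / 2) / (η * w * D + 1) := by ring
      _ ≤ e / 2 := by
          rw [div_le_iff₀ (by positivity)]
          nlinarith
  have hnot : ¬ HasLipschitzSmoothApprox p U (fun x => f (A' x + (s - w) • x)) L := by
    intro hgood
    obtain ⟨K, hK⟩ := hgood (e / 2) (half_pos he) d hd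
    obtain ⟨x, hx, hxK⟩ := hbad K
    obtain ⟨h1, h2, h3⟩ := hK x hx
    refine hxK h1 ?_ (h3.mono fun y hy => not_lt.2 hy)
    have := norm_sub_le_norm_sub_add_norm_sub (K x) (f (A' x + (s - w) • x)) (f (A x + s • x))
    linarith [hclose x]
  obtain ⟨k, hk⟩ : ∃ k, ¬ HasLipschitzSmoothApprox p
      (U ∩ {x | ‖tailProj b (max n N + k) x‖ < κ}) (fun x => f (A' x + (s - w) • x)) L := by
    by_contra! hall
    exact hnot (HasLipschitzSmoothApprox.of_tail hH hκ (max n N) hall)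
  set M := max n N + k with hM
  have hnM : n ≤ M := (le_max_left _ _).trans (Nat.le_add_right _ _)
  have hNM : N ≤ M := (le_max_right _ _).trans (Nat.le_add_right _ _)
  set S : Set X := {r | headProj b M r = r ∧ headProj b m r = 0 ∧ ‖r‖ ≤ c} with hS
  refine ⟨(fun q : X × X => q.1 + w • q.2) '' Y ×ˢ S, ⟨?_, by linarith, ?_, ?_⟩, ?_⟩
  · exact (h.isCompact.prod (isCompact_block b m M c)).image (by fun_prop)
  · rintro _ ⟨⟨y, r⟩, ⟨hy, -, hr0, hr⟩, rfl⟩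
    have h1 := hm y (hYC hy) w hw.le hww r hr0 hr
    have h2 := h.potential_le y hy
    change φ (y + w • r) ≤ _
    linarith
  · refine ⟨_, A', M, ?_, ?_, ?_, ?_, hk⟩
    · exact hU.inter (isOpen_lt (tailProj b M).continuous.norm continuous_const)
    · rintro x ⟨hx, -⟩
      exact (hA x hx).add (hΨp.contDiffAt.const_smul w)
    · rintro x ⟨hx, hxκ⟩
      simp only [hA']
      rw [map_add, map_smul, headProj_eq_self_of_le b hnM (hAn x hx), hΨN M hNM x hxκ]
    · rintro x ⟨hx, hxκ⟩ x' ⟨hx', hxκ'⟩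
      obtain ⟨a, y, hy, hay, ha⟩ := hAd x hx x' hx'
      set v := Ψ x - Ψ x' - T (x - x') with hv
      have hvn : ‖v‖ ≤ c * ‖x - x'‖ := hΨc x x'
      have hvM : headProj b M v = v := by
        rw [hv, map_sub, map_sub, hΨN M hNM x hxκ, hΨN M hNM x' hxκ', hTN M hNM]
      have hr : ‖x - x'‖ • ‖x - x'‖⁻¹ • v = v := by
        rcases eq_or_ne ‖x - x'‖ 0 with h0 | h0
        · rw [h0, mul_zero] at hvn
          rw [norm_le_zero_iff.1 hvn, smul_zero, smul_zero]
        · exact smul_inv_smul₀ h0 v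
      refine ⟨a + w • T (x - x'), _, ⟨(y, ‖x - x'‖⁻¹ • v), ⟨hy, ?_, ?_, ?_⟩, rfl⟩, ?_, ?_⟩
      · rw [map_smul, hvM]
      · rw [map_smul, hΨm, smul_zero]
      · rw [norm_smul, norm_inv, norm_norm]
        exact inv_mul_le_of_le_mul₀ (norm_nonneg _) hc (by rwa [mul_comm] at hvn)
      · rw [smul_add, smul_comm ‖x - x'‖ w, hr, hv,
          show A' x - A' x' = A x - A x' + w • (Ψ x - Ψ x') by
            simp only [hA', smul_sub]; abel, hay]
        simp only [smul_sub]
        abel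
      · refine (norm_add_le _ _).trans ?_
        rw [norm_smul, Real.norm_of_nonneg hw.le]
        nlinarith [mul_le_mul_of_nonneg_left (hT (x - x')) hw.le]
  · rintro _ ⟨⟨y, r⟩, ⟨hy, -, -, hr⟩, rfl⟩
    refine ⟨y, hy, ?_⟩
    rw [add_sub_cancel_left, norm_smul, Real.norm_of_nonneg hw.le, mul_comm]
    gcongr

theorem hasLipschitzSmoothApprox_univ [CompleteSpace X] [CompleteSpace Z] {B : ℝ}
    (hB : IsBasisBound b B) (hp : 1 ≤ p) {H : X → ℝ} {R Λ : ℝ} (hH : IsSmoothCutoff p H R Λ)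
    (hη : 0 ≤ η) (hf : ∀ x y, ‖f x - f y‖ ≤ η * ‖x - y‖) :
    HasLipschitzSmoothApprox p univ f (3 * η) := by
  have hR := hH.one_le_radius
  by_contra hbad
  set φ : X → ℝ := fun x => H (R • x) with hφ
  have hφ1 : ContDiff ℝ 1 φ :=
    (hH.contDiff.of_le (by exact_mod_cast hp)).comp (contDiff_const_smul R)
  have hφle : ∀ y, φ y ≤ 1 / 2 → ‖y‖ ≤ 1 := by
    intro y hy
    by_contra! h
    have : φ y = 1 := hH.eq_one _ (by
      rw [norm_smul, Real.norm_of_nonneg (by linarith)]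
      nlinarith)
    linarith
  obtain ⟨c, hc, hstep⟩ := exists_uniform_obstruction_step hB hp hH hφ1 hη hf
  refine not_of_uniform_steps (IsObstruction b p φ f (3 * η)) hc
    (fun Y s h => ⟨h.isCompact, h.pos hη hf hφle⟩) (fun C hC => ?_) {0} 1
    ⟨isCompact_singleton, zero_le_one, ?_, univ, fun _ => 0, 0, isOpen_univ,
      fun x _ => contDiffAt_const, fun x _ => map_zero _, fun x _ x' _ => ⟨0, 0, rfl, ?_, ?_⟩, ?_⟩
  · obtain ⟨w₀, hw₀, h⟩ := hstep C hC
    exact ⟨w₀, hw₀, fun Y s => h (3 * η) Y s⟩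
  · rintro _ rfl
    simp only [hφ, smul_zero]
    rw [hH.eq_zero 0 (by simp)]
    norm_num
  · simp
  · simp
  · simpa using hbad

end Obstruction

theorem norm_sub_le_of_eventually_norm_sub_le {X Z : Type*} [NormedAddCommGroup X]
    [NormedSpace ℝ X] [NormedAddCommGroup Z] [NormedSpace ℝ Z] {K : X → Z}
    (hK : Differentiable ℝ K) {L : ℝ} (hL : 0 ≤ L)
    (h : ∀ x, ∀ᶠ y in 𝓝 x, ‖K y - K x‖ ≤ L * ‖y - x‖) (x y : X) :
    ‖K x - K y‖ ≤ L * ‖x - y‖ :=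
  convex_univ.norm_image_sub_le_of_norm_fderiv_le (𝕜 := ℝ) (fun z _ => hK z)
    (fun z _ => (hK z).hasFDerivAt.le_of_lip' hL (h z)) (mem_univ y) (mem_univ x)

/-- Remark: with the better derivative estimates, for every `δ > 0` the `C^p`-smooth
`ε`-approximation `K` of an `η`-Lipschitz map `f : X → Z` can be chosen with Lipschitz
constant at most `(η + δ)(2(2 + δ)M² + 1)`. -/
theorem smooth_approx_improved_lipschitz_constant
    {X : Type*} [NormedAddCommGroup X] [NormedSpace ℝ X] [CompleteSpace X]
    {Z : Type*} [NormedAddCommGroup Z] [NormedSpace ℝ Z] [CompleteSpace Z]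
    (p : ℕ∞) (hp : 1 ≤ p)
    (hbasis : HasUnconditionalSchauderBasis X)
    (hbump : HasLipschitzSmoothBump X p)
    (M : ℝ) (hM : 1 ≤ M)
    (μA : X → ℝ) (hμ_lip : ∃ C : NNReal, LipschitzWith C μA)
    (hμ_nonneg : ∀ x : X, 0 ≤ μA x)
    (hμ_smooth : ContDiffOn ℝ p μA {(0 : X)}ᶜ)
    (hμ_homog : ∀ (t : ℝ) (x : X), μA (t • x) = |t| * μA x)
    (hμ_lower : ∀ x : X, (1 / M) * ‖x‖ ≤ μA x)
    (hμ_upper : ∀ x : X, μA x ≤ M * ‖x‖)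
    (hμ_deriv : ∀ x : X, x ≠ 0 → ‖fderiv ℝ μA x‖ ≤ M)
    (f : X → Z) (η : ℝ) (hη : 0 ≤ η)
    (hf : ∀ x x' : X, ‖f x - f x'‖ ≤ η * ‖x - x'‖)
    (ε : ℝ) (hε : 0 < ε) (δ : ℝ) (hδ : 0 < δ) :
    ∃ K : X → Z, ContDiff ℝ p K ∧ (∀ x : X, ‖f x - K x‖ < ε) ∧
      ∀ x x' : X,
        ‖K x - K x'‖ ≤ (η + δ) * (2 * (2 + δ) * M ^ 2 + 1) * ‖x - x'‖ := by
  obtain ⟨b⟩ := hbasis.nonempty_unconditionalSchauderBasis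
  obtain ⟨B, hB⟩ := exists_isBasisBound b
  obtain ⟨H, R, Λ, hH⟩ := exists_isSmoothCutoff hM hμ_lip hμ_smooth hμ_nonneg hμ_lower hμ_upper
  obtain ⟨K, hK⟩ := hasLipschitzSmoothApprox_univ hB hp hH hη hf (ε / 2) (half_pos hε) δ hδ
  have hKp : ContDiff ℝ p K := contDiff_iff_contDiffAt.2 fun x => (hK x (mem_univ x)).1
  refine ⟨K, hKp, fun x => ?_, fun x x' => ?_⟩
  · rw [norm_sub_rev]
    exact (hK x (mem_univ x)).2.1.trans_lt (half_lt_self hε)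
  · have hp0 : (p : WithTop ℕ∞) ≠ 0 := by
      exact_mod_cast (zero_lt_one.trans_le hp).ne'
    refine (norm_sub_le_of_eventually_norm_sub_le (hKp.differentiable hp0)
      (by positivity : 0 ≤ 3 * η + δ) (fun z => (hK z (mem_univ z)).2.2) x x').trans ?_
    gcongr
    have hM2 : 1 ≤ M ^ 2 := one_le_pow₀ hM
    have h5 : 5 ≤ 2 * (2 + δ) * M ^ 2 + 1 := by nlinarith
    nlinarith
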